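/- Let d ≥ 2. Then there exists α₀ = α₀(d) > 0 with the following property: with ω(t) = t(log(1/t))^{α₀} (defined on a suitable interval (0, a) with a ∈ (0,1)), the set of functions ρ ∈ L^∞(I^d) that are positive almost everywhere and for which the pushforward equation f_♯(ρ·L) = L restricted to f(I^d) admits an injective bi-ω solution f : I^d → ℝ^d forms a σ-porous subset of the space L^∞(I^d) with the essential supremum norm. -/

import Mathlib

open MeasureTheory Metric Set Filter

noncomputable section

/-- `ℝ^d` with the Euclidean norm. -/
abbrev Euc (d : ℕ) := EuclideanSpace ℝ (Fin d)

/-- The integer lattice `ℤ^d ⊆ ℝ^d`. -/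
def intLattice (d : ℕ) : Set (Euc d) := {x | ∀ i, ∃ m : ℤ, x i = (m : ℝ)}

/-- The unit cube `I^d = [0,1]^d ⊆ ℝ^d`. -/
def unitCube (d : ℕ) : Set (Euc d) := {x | ∀ i, x i ∈ Icc (0:ℝ) 1}

/-- `X` is a separated net in `ℝ^d`: it is `r`-separated and an `s`-net for some `r, s > 0`. -/
def IsSeparatedNet {d : ℕ} (X : Set (Euc d)) : Prop :=
  ∃ r s : ℝ, 0 < r ∧ 0 < s ∧
    (∀ x ∈ X, ∀ y ∈ X, x ≠ y → r ≤ dist x y) ∧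
    ∀ z : Euc d, ∃ x ∈ X, dist z x ≤ s

/-- Membership of `ω : (0, a) → (0, ∞)` in the class `𝓜` of strictly increasing, concave,
submultiplicative moduli of continuity with `ω(t) ≥ t` and `ω(t) → 0` as `t → 0⁺`;
here `ω` is represented as a total function `ℝ → ℝ`, only its values on `(0, a)` matter. -/
structure MemM (ω : ℝ → ℝ) (a : ℝ) : Prop where
  a_pos : 0 < a
  a_le_one : a ≤ 1
  mono : StrictMonoOn ω (Ioo 0 a)
  concave : ConcaveOn ℝ (Ioo 0 a) ω
  subm : ∀ s ∈ Ioo (0:ℝ) a, ∀ t ∈ Ioo (0:ℝ) a, ω (s * t) ≤ ω s * ω t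
  pos : ∀ t ∈ Ioo (0:ℝ) a, 0 < ω t
  le_omega : ∀ t ∈ Ioo (0:ℝ) a, t ≤ ω t
  tendsto_zero : Tendsto ω (nhdsWithin 0 (Ioi 0)) (nhds 0)

/-- `f` is a bi-`ω`-mapping on `A` (with `ω` a modulus defined on `(0, a)`): `f` is injective on
`A` and there is `K > 0` with `dist (f x) (f y) ≤ K ω (dist x y)` and
`dist x y ≤ K ω (dist (f x) (f y))`, the bounds being imposed only when the argument of `ω` lies
in `(0, a)`. -/
def IsBiOmegaMapOn {E F : Type*} [PseudoMetricSpace E] [PseudoMetricSpace F]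
    (ω : ℝ → ℝ) (a : ℝ) (f : E → F) (A : Set E) : Prop :=
  Set.InjOn f A ∧
  ∃ K : ℝ, 0 < K ∧
    (∀ x ∈ A, ∀ y ∈ A, 0 < dist x y → dist x y < a →
      dist (f x) (f y) ≤ K * ω (dist x y)) ∧
    (∀ x ∈ A, ∀ y ∈ A, 0 < dist (f x) (f y) → dist (f x) (f y) < a →
      dist x y ≤ K * ω (dist (f x) (f y)))

/-- A set `P` in a metric space is porous. -/
def IsPorous {E : Type*} [PseudoMetricSpace E] (P : Set E) : Prop :=
  ∀ x : E, ∃ ε₀ : ℝ, 0 < ε₀ ∧ ∃ α ∈ Ioo (0:ℝ) 1, ∀ ε ∈ Ioo (0:ℝ) ε₀,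
    ∃ y : E, dist y x ≤ ε ∧ ball y (α * ε) ∩ P = ∅

/-- A set is σ-porous if it is a countable union of porous sets. -/
def IsSigmaPorous {E : Type*} [PseudoMetricSpace E] (P : Set E) : Prop :=
  ∃ F : ℕ → Set E, (∀ n, IsPorous (F n)) ∧ P = ⋃ n, F n

/-- `f : X → ℝ^d` is a homogeneous `ω`-mapping with some constant `K > 0`, for a modulus `ω`
defined on `(0, a)`:  `‖f x₂ - f x₁‖ ≤ K R ω (‖x₂ - x₁‖ / R)` for all `R > 0` and
`x₁, x₂ ∈ X ∩ B(0, R)`, the bound being imposed only when the argument of `ω` lies in `(0,a)`. -/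
def IsHomogeneousOmegaMap {d : ℕ} (ω : ℝ → ℝ) (a : ℝ)
    (A : Set (Euc d)) (f : Euc d → Euc d) : Prop :=
  ∃ K : ℝ, 0 < K ∧ ∀ R : ℝ, 0 < R → ∀ x₁ ∈ A ∩ ball 0 R, ∀ x₂ ∈ A ∩ ball 0 R,
    0 < dist x₂ x₁ / R → dist x₂ x₁ / R < a →
      dist (f x₂) (f x₁) ≤ K * R * ω (dist x₂ x₁ / R)

/-- Two sets `X, Y ⊆ ℝ^d` are bi-`ω` equivalent: there is a bijection `f : X → Y` such that
both `f` and `f⁻¹` are homogeneous `ω`-mappings. -/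
def BiOmegaEquiv {d : ℕ} (ω : ℝ → ℝ) (a : ℝ) (X Y : Set (Euc d)) : Prop :=
  ∃ f g : Euc d → Euc d, Set.BijOn f X Y ∧ Set.InvOn g f X Y ∧
    IsHomogeneousOmegaMap ω a X f ∧ IsHomogeneousOmegaMap ω a Y g

section Topology

variable {E : Type*} [NormedAddCommGroup E] [InnerProductSpace ℝ E] [FiniteDimensional ℝ E]

/-- The value at `1` of the polynomial `t ↦ det (1 + t A)` is a fixed linear combination of its
values at finitely many points of `(0, t₀]`. -/
lemma exists_det_interpolation {t₀ : ℝ} (ht₀ : 0 < t₀) :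
    ∃ (s : Finset ℝ) (w : ℝ → ℝ), (∀ t ∈ s, 0 < t ∧ t ≤ t₀) ∧
      ∀ A : E →L[ℝ] E, ContinuousLinearMap.det (1 + A) =
        ∑ t ∈ s, w t * ContinuousLinearMap.det (1 + t • A) := by
  classical
  set n := Module.finrank ℝ E
  let b := Module.finBasis ℝ E
  have hinj : Function.Injective (fun k : ℕ => t₀ / (k + 1)) := by
    intro k l hkl
    have h1 : (0 : ℝ) < k + 1 := by positivity
    have h2 : (0 : ℝ) < l + 1 := by positivity
    have hkl' : t₀ / ((k : ℝ) + 1) = t₀ / ((l : ℝ) + 1) := hkl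
    rw [div_eq_div_iff h1.ne' h2.ne'] at hkl'
    have := mul_left_cancel₀ ht₀.ne' hkl'
    have h3 : (l : ℝ) = k := by linarith
    exact_mod_cast h3.symm
  let s : Finset ℝ := (Finset.range (n + 1)).image (fun k : ℕ => t₀ / (k + 1))
  have hcard : s.card = n + 1 := by
    rw [Finset.card_image_of_injective _ hinj, Finset.card_range]
  refine ⟨s, fun t => (Lagrange.basis s id t).eval 1, ?_, ?_⟩
  · intro t ht
    obtain ⟨k, -, rfl⟩ := Finset.mem_image.1 ht
    have h1 : (0 : ℝ) < k + 1 := by positivity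
    refine ⟨by positivity, ?_⟩
    rw [div_le_iff₀ h1]
    nlinarith [(Nat.cast_nonneg k : (0 : ℝ) ≤ k)]
  · intro A
    let Am := LinearMap.toMatrix b b (A : E →ₗ[ℝ] E)
    let P : Polynomial ℝ :=
      ((Polynomial.X : Polynomial ℝ) • Am.map Polynomial.C +
        (1 : Matrix (Fin n) (Fin n) ℝ).map Polynomial.C).det
    have hP : ∀ t : ℝ, P.eval t = ContinuousLinearMap.det (1 + t • A) := by
      intro t
      have e1 : P.eval t = (1 + t • Am).det := by
        rw [← Polynomial.coe_evalRingHom t, RingHom.map_det]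
        refine congrArg Matrix.det ?_
        ext i j
        simp [Matrix.one_apply, apply_ite]
        ring_nf
        split_ifs <;> ring
      have e2 : 1 + t • Am = LinearMap.toMatrix b b ((1 + t • A : E →L[ℝ] E) : E →ₗ[ℝ] E) := by
        simp only [ContinuousLinearMap.toLinearMap_add, ContinuousLinearMap.toLinearMap_smul,
          map_add, map_smul]
        congr 1
        exact (LinearMap.toMatrix_one b).symm
      rw [e1, e2, LinearMap.det_toMatrix]
    have hdeg : P.degree < s.card := by
      refine lt_of_le_of_lt Polynomial.degree_le_natDegree ?_
      have := Polynomial.natDegree_det_X_add_C_le Am 1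
      rw [Fintype.card_fin] at this
      rw [hcard]
      exact_mod_cast Nat.lt_succ_of_le this
    have h := Lagrange.eq_interpolate (v := id) (injOn_id _) hdeg
    have h1 := congrArg (Polynomial.eval 1) h
    rw [hP, one_smul, Lagrange.interpolate_apply, Polynomial.eval_finsetSum] at h1
    rw [h1]
    refine Finset.sum_congr rfl fun t _ => ?_
    rw [Polynomial.eval_mul, Polynomial.eval_C, id, hP, mul_comm]

lemma det_eq_zero_of_norm_eq_one {r : E → E} {r' : E →L[ℝ] E} {x : E}
    (hr : HasFDerivAt r r' x) (h1 : ∀ y, ‖r y‖ = 1) : r'.det = 0 := by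
  by_contra hdet
  have hsurj : Function.Surjective r' := by
    have := (LinearMap.isUnit_iff_isUnit_det (r' : E →ₗ[ℝ] E)).2 (isUnit_iff_ne_zero.2 hdet)
    exact ((Module.End.isUnit_iff _).1 this).2
  obtain ⟨v, hv⟩ := hsurj (r x)
  have hc : HasFDerivAt (fun y => inner ℝ (r y) (r y)) (0 : E →L[ℝ] ℝ) x := by
    have : (fun y => inner ℝ (r y) (r y)) = fun _ => (1 : ℝ) := by
      funext y
      rw [real_inner_self_eq_norm_sq, h1]; norm_num
    rw [this]
    exact hasFDerivAt_const _ _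
  have hd := (hr.inner ℝ hr).unique hc
  have := DFunLike.congr_fun hd v
  simp [hv, h1] at this

end Topology
section Topology

variable {E : Type*} [NormedAddCommGroup E] [InnerProductSpace ℝ E] [FiniteDimensional ℝ E]

/-- A Lipschitz perturbation of the identity supported in the unit ball maps the open unit ball
bijectively onto itself, if the Lipschitz constant is less than one. -/
lemma injective_and_image_ball_of_lipschitz {u : E → E} {C : NNReal} (hC : C < 1)
    (hu : LipschitzWith C u) (h0 : ∀ x, 1 ≤ ‖x‖ → u x = 0) :
    Function.Injective (fun x => x + u x) ∧ (fun x => x + u x) '' ball 0 1 = ball 0 1 := by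
  have happ : ApproximatesLinearOn (fun x => x + u x)
      ((ContinuousLinearEquiv.refl ℝ E : E ≃L[ℝ] E) : E →L[ℝ] E) univ C := by
    rw [ApproximatesLinearOn.approximatesLinearOn_iff_lipschitzOnWith, lipschitzOnWith_univ]
    convert! hu using 1
    funext x
    simp
  have hnorm : Subsingleton E ∨
      C < ‖((ContinuousLinearEquiv.refl ℝ E).symm : E →L[ℝ] E)‖₊⁻¹ := by
    rcases subsingleton_or_nontrivial E with h | h
    · exact Or.inl h
    · right
      have : ‖((ContinuousLinearEquiv.refl ℝ E).symm : E →L[ℝ] E)‖₊ = 1 := by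
        ext
        simp
      rw [this, inv_one]
      exact hC
  have hinj' : Function.Injective (fun x => x + u x) := injOn_univ.1 (happ.injOn hnorm)
  have hsurj := happ.surjective hnorm
  refine ⟨hinj', ?_⟩
  ext y
  simp only [mem_image, mem_ball_zero_iff]
  constructor
  · rintro ⟨x, hx, rfl⟩
    by_contra hy
    have hy' := h0 _ (not_lt.1 hy)
    have : x + u x = x := hinj' (by simp only [hy', add_zero])
    rw [this] at hy
    exact hy hx
  · intro hy
    obtain ⟨x, hx⟩ := hsurj y
    refine ⟨x, ?_, hx⟩
    by_contra hx'
    have hx2 := h0 _ (not_lt.1 hx')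
    simp only [hx2, add_zero] at hx
    rw [hx] at hx'
    exact hx' hy

/-- There is no nowhere vanishing `C¹` map which is the identity outside the unit ball. -/
theorem not_exists_contDiff_ne_zero {h : E → E} (hs : ContDiff ℝ 1 h) (hne : ∀ x, h x ≠ 0)
    (hid : ∀ x, 1 ≤ ‖x‖ → h x = x) : False := by
  let _ : MeasurableSpace E := borel E
  have : BorelSpace E := ⟨rfl⟩
  set r : E → E := fun x => ‖h x‖⁻¹ • h x with hrdef
  have hr : ContDiff ℝ 1 r := ((hs.norm ℝ hne).inv (fun x => norm_ne_zero_iff.2 (hne x))).smul hs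
  have hr1 : ∀ x, ‖r x‖ = 1 := fun x => by
    rw [hrdef]
    simp only [norm_smul, norm_inv, norm_norm]
    exact inv_mul_cancel₀ (norm_ne_zero_iff.2 (hne x))
  have hrid : ∀ x, ‖x‖ = 1 → r x = x := fun x hx => by
    rw [hrdef]
    simp only [hid x hx.ge, hx, inv_one, one_smul]
  set g : E → E := fun x => r x - x with hgdef
  have hg : ContDiff ℝ 1 g := hr.sub contDiff_id
  obtain ⟨C, hC⟩ := (hg.contDiffOn (s := closedBall 0 1)).exists_lipschitzOnWith one_ne_zero
    (convex_closedBall 0 1) (isCompact_closedBall 0 1)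
  classical
  set u : E → E := fun x => if ‖x‖ ≤ 1 then g x else 0 with hudef
  have hu_in : ∀ x, ‖x‖ ≤ 1 → u x = g x := fun x hx => if_pos hx
  have hu_out : ∀ x, 1 ≤ ‖x‖ → u x = 0 := fun x hx => by
    rcases hx.eq_or_lt with hx | hx
    · rw [hu_in x hx.ge, hgdef]; simp only [hrid x hx.symm, sub_self]
    · exact if_neg (not_le.2 hx)
  have hmix : ∀ x y, ‖x‖ ≤ 1 → 1 ≤ ‖y‖ → dist (u x) (u y) ≤ C * dist x y := by
    intro x y hx hy
    have hcont : ContinuousOn (fun t : ℝ => ‖AffineMap.lineMap x y t‖) (Icc 0 1) :=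
      (continuous_norm.comp (AffineMap.lineMap_continuous)).continuousOn
    obtain ⟨t, ht, htz⟩ := intermediate_value_Icc (zero_le_one' ℝ) hcont
      (show (1 : ℝ) ∈ Icc _ _ by simpa using ⟨hx, hy⟩)
    set z := AffineMap.lineMap x y t
    have htz' : ‖z‖ = 1 := htz
    rw [hu_out y hy, ← hu_out z htz'.ge, hu_in x hx, hu_in z htz'.le]
    refine (hC.dist_le_mul x (by simpa using hx) z (by simpa using htz'.le)).trans ?_
    refine mul_le_mul_of_nonneg_left ?_ C.2
    rw [dist_left_lineMap, Real.norm_of_nonneg ht.1]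
    exact mul_le_of_le_one_left dist_nonneg ht.2
  have hu : LipschitzWith C u := by
    refine LipschitzWith.of_dist_le_mul fun x y => ?_
    rcases le_total ‖x‖ 1 with hx | hx <;> rcases le_total ‖y‖ 1 with hy | hy
    · rw [hu_in x hx, hu_in y hy]
      exact hC.dist_le_mul x (by simpa using hx) y (by simpa using hy)
    · exact hmix x y hx hy
    · rw [dist_comm, dist_comm x]; exact hmix y x hy hx
    · rw [hu_out x hx, hu_out y hy, dist_self]; positivity
  have hgd : ∀ x, HasFDerivAt g (fderiv ℝ g x) x := fun x =>
    (hg.differentiable one_ne_zero x).hasFDerivAt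
  have hfc : Continuous (fderiv ℝ g) := hg.continuous_fderiv one_ne_zero
  obtain ⟨D, hD⟩ := (isCompact_closedBall (0 : E) 1).exists_bound_of_continuousOn hfc.continuousOn
  obtain ⟨η, hη, hdet⟩ : ∃ η > 0, ∀ T : E →L[ℝ] E, dist T 1 < η → 0 < T.det := by
    have h1 : (1 : E →L[ℝ] E).det = 1 := LinearMap.det_id
    have := (ContinuousLinearMap.continuous_det (𝕜 := ℝ) (E := E)).continuousAt.eventually
      (lt_mem_nhds (show 0 < (1 : E →L[ℝ] E).det by rw [h1]; exact one_pos))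
    obtain ⟨η, hη, h⟩ := Metric.eventually_nhds_iff.1 this
    exact ⟨η, hη, fun T hT => h hT⟩
  set t₀ : ℝ := min (1 / (C + 1) / 2) (η / (|D| + 1) / 2) with ht₀def
  have ht₀ : 0 < t₀ := by positivity
  have hvol : ∀ t, 0 < t → t ≤ t₀ →
      ∫ x in ball (0 : E) 1, ContinuousLinearMap.det (1 + t • fderiv ℝ g x) =
        (volume : Measure E).real (ball 0 1) := by
    intro t ht htt
    have htC : t * C < 1 := by
      have h1 : t ≤ 1 / (C + 1) / 2 := htt.trans (min_le_left _ _)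
      have h2 : (0 : ℝ) < C + 1 := by positivity
      rw [div_div, le_div_iff₀ (by positivity)] at h1
      nlinarith [C.2]
    have htη : ∀ x ∈ ball (0 : E) 1, 0 < ContinuousLinearMap.det (1 + t • fderiv ℝ g x) := by
      intro x hx
      apply hdet
      rw [dist_eq_norm, add_sub_cancel_left, norm_smul, Real.norm_of_nonneg ht.le]
      have h1 : t ≤ η / (|D| + 1) / 2 := htt.trans (min_le_right _ _)
      rw [div_div, le_div_iff₀ (by positivity)] at h1
      have h2 := hD x (ball_subset_closedBall hx)
      have h3 := le_abs_self D
      nlinarith [abs_nonneg D]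
    have hlip : LipschitzWith (Real.toNNReal t * C) (fun x => t • u x) := by
      refine LipschitzWith.of_dist_le_mul fun x y => ?_
      rw [dist_smul₀, Real.norm_of_nonneg ht.le, NNReal.coe_mul, Real.coe_toNNReal t ht.le,
        mul_assoc]
      exact mul_le_mul_of_nonneg_left (hu.dist_le_mul x y) ht.le
    obtain ⟨hinj, himg⟩ := injective_and_image_ball_of_lipschitz (u := fun x => t • u x)
      (C := Real.toNNReal t * C) (by
        rw [← NNReal.coe_lt_coe, NNReal.coe_mul, Real.coe_toNNReal t ht.le]
        exact htC) hlip
      (fun x hx => by simp only [hu_out x hx, smul_zero])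
    have heq : EqOn (fun x => x + t • u x) (fun x => x + t • g x) (ball 0 1) := fun x hx => by
      simp only [hu_in x (by simpa using (mem_ball_zero_iff.1 hx).le)]
    have hinj' : InjOn (fun x => x + t • g x) (ball 0 1) := hinj.injOn.congr heq
    have himg' : (fun x => x + t • g x) '' ball 0 1 = ball 0 1 := 
      heq.image_eq.symm.trans himg
    have hcv := integral_image_eq_integral_abs_det_fderiv_smul (volume : Measure E)
      (measurableSet_ball (x := (0 : E)) (ε := 1))
      (f := fun x => x + t • g x) (f' := fun x => 1 + t • fderiv ℝ g x)
      (fun x _ => ((hasFDerivAt_id x).add ((hgd x).const_smul t)).hasFDerivWithinAt)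
      hinj' (fun _ => (1 : ℝ))
    rw [himg'] at hcv
    simp only [smul_eq_mul, mul_one, integral_const, measureReal_restrict_apply_univ] at hcv
    rw [hcv]
    refine setIntegral_congr_fun measurableSet_ball fun x hx => ?_
    exact (abs_of_pos (htη x hx)).symm
  obtain ⟨s, w, hsw, hint⟩ := exists_det_interpolation (E := E) ht₀
  have hsum : ∑ t ∈ s, w t = 1 := by
    have := hint 0
    simp only [smul_zero, add_zero] at this
    have h1 : (1 : E →L[ℝ] E).det = 1 := LinearMap.det_id
    simpa [h1] using this.symm
  have hzero : ∀ x, ContinuousLinearMap.det (1 + fderiv ℝ g x) = 0 := by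
    intro x
    refine det_eq_zero_of_norm_eq_one (r := r) (x := x) ?_ hr1
    have := (hasFDerivAt_id (𝕜 := ℝ) x).add (hgd x)
    refine this.congr_of_eventuallyEq (Eventually.of_forall fun y => ?_)
    exact (add_sub_cancel y (r y)).symm
  have hI : ∀ t : ℝ, IntegrableOn (fun x => ContinuousLinearMap.det (1 + t • fderiv ℝ g x))
      (ball (0 : E) 1) volume := by
    intro t
    have hc : Continuous (fun x => ContinuousLinearMap.det (1 + t • fderiv ℝ g x)) :=
      ContinuousLinearMap.continuous_det.comp (continuous_const.add (hfc.const_smul t))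
    exact (hc.continuousOn.integrableOn_compact (isCompact_closedBall 0 1)).mono_set
      ball_subset_closedBall
  have h1 : ∫ x in ball (0 : E) 1, ContinuousLinearMap.det (1 + fderiv ℝ g x) = 0 := by
    simp [hzero]
  rw [show (fun x => ContinuousLinearMap.det (1 + fderiv ℝ g x)) = fun x => ∑ t ∈ s, w t *
    ContinuousLinearMap.det (1 + t • fderiv ℝ g x) from funext fun x => hint _] at h1
  rw [integral_finsetSum _ (fun t _ => (hI t).const_mul _)] at h1
  simp_rw [integral_const_mul] at h1
  rw [Finset.sum_congr rfl (fun t ht => by rw [hvol t (hsw t ht).1 (hsw t ht).2]),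
    ← Finset.sum_mul, hsum, one_mul] at h1
  have hpos : 0 < (volume : Measure E).real (ball 0 1) :=
    ENNReal.toReal_pos (measure_ball_pos _ _ one_pos).ne' measure_ball_lt_top.ne
  exact hpos.ne' h1

end Topology
section InvarianceOfDomain

variable {E : Type*} [NormedAddCommGroup E] [InnerProductSpace ℝ E] [FiniteDimensional ℝ E]

/-- A continuous map of the unit ball which is uniformly close to the identity has a zero. -/
lemma exists_eq_zero_of_norm_sub_le {h : E → E} (hc : ContinuousOn h (closedBall 0 1))
    (hb : ∀ x ∈ closedBall (0 : E) 1, ‖h x - x‖ ≤ 1 / 2) : ∃ x ∈ closedBall (0 : E) 1, h x = 0 := by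
  by_contra! hne
  set π : E → E := fun x => (max 1 ‖x‖)⁻¹ • x with hπ
  have hmax : ∀ x : E, 0 < max 1 ‖x‖ := fun x => lt_max_of_lt_left one_pos
  have hπc : Continuous π := by
    refine Continuous.smul (Continuous.inv₀ (by fun_prop) fun x => (hmax x).ne') continuous_id
  have hπb : ∀ x, π x ∈ closedBall (0 : E) 1 := fun x => by
    rw [mem_closedBall_zero_iff, hπ]
    simp only [norm_smul, norm_inv, Real.norm_of_nonneg (hmax x).le]
    rw [inv_mul_le_iff₀ (hmax x), mul_one]
    exact le_max_right _ _
  have hπid : ∀ x, ‖x‖ ≤ 1 → π x = x := fun x hx => by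
    simp only [hπ, max_eq_left hx, inv_one, one_smul]
  set χ : ℝ → ℝ := fun s => min 1 (max 0 (3 - 4 * s)) with hχ
  have hχc : Continuous χ := by fun_prop
  have hχ0 : ∀ s, 0 ≤ χ s := fun s => le_min zero_le_one (le_max_left _ _)
  have hχ1 : ∀ s, χ s ≤ 1 := fun s => min_le_left _ _
  have hχone : ∀ s, s ≤ 1 / 2 → χ s = 1 := fun s hs => by
    refine min_eq_left (le_max_of_le_right (by linarith))
  have hχzero : ∀ s, 3 / 4 ≤ s → χ s = 0 := fun s hs => by
    simp only [hχ]
    rw [max_eq_left (by linarith)]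
    exact min_eq_right zero_le_one
  set k : E → E := fun x => x + χ ‖x‖ • (h (π x) - x) with hk
  have hhc : Continuous fun x => h (π x) := hc.comp_continuous hπc hπb
  have hkc : Continuous k :=
    continuous_id.add ((hχc.comp continuous_norm).smul (hhc.sub continuous_id))
  have hkout : ∀ x, 3 / 4 ≤ ‖x‖ → k x = x := fun x hx => by
    simp only [hk, hχzero _ hx, zero_smul, add_zero]
  have hkne : ∀ x, k x ≠ 0 := by
    intro x
    rcases le_or_gt ‖x‖ (1 / 2) with hx | hx
    · have hx1 : ‖x‖ ≤ 1 := by linarith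
      have : k x = h x := by
        simp only [hk, hχone _ hx, one_smul, hπid x hx1, add_sub_cancel]
      rw [this]
      exact hne x (mem_closedBall_zero_iff.2 hx1)
    · rcases le_or_gt (3 / 4) ‖x‖ with hx2 | hx2
      · rw [hkout x hx2]
        exact norm_pos_iff.1 (by linarith)
      · intro h0
        have h1 : ‖χ ‖x‖ • (h (π x) - x)‖ ≤ 1 / 2 := by
          have hx1 : ‖x‖ ≤ 1 := by linarith
          rw [hπid x hx1, norm_smul, Real.norm_of_nonneg (hχ0 _)]
          have := hb x (mem_closedBall_zero_iff.2 hx1)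
          exact (mul_le_of_le_one_left (norm_nonneg _) (hχ1 _)).trans this
        have h2 : χ ‖x‖ • (h (π x) - x) = -x := by
          rw [eq_neg_iff_add_eq_zero, add_comm]; exact h0
        rw [h2, norm_neg] at h1
        linarith
  obtain ⟨g, hg, hgk, hgeq, -⟩ := hkc.exists_contDiff_approx_and_eqOn 1
    (ε := fun x => ‖k x‖ / 2) (by fun_prop) (fun x => half_pos (norm_pos_iff.2 (hkne x)))
    (S := {x : E | 1 ≤ ‖x‖}) (U := {x : E | 3 / 4 < ‖x‖})
    (isClosed_le continuous_const continuous_norm)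
    ((isOpen_lt continuous_const continuous_norm).mem_nhdsSet.2
      fun x (hx : 1 ≤ ‖x‖) => show 3 / 4 < ‖x‖ by linarith)
    (contDiffOn_id.congr fun x (hx : 3 / 4 < ‖x‖) => hkout x hx.le)
  refine not_exists_contDiff_ne_zero hg (fun x hx => ?_)
    fun x hx => (hgeq hx).trans (hkout x (by linarith))
  have h1 := hgk x
  rw [hx, dist_zero_left] at h1
  linarith [norm_pos_iff.2 (hkne x)]

/-- If a continuous injective map `f` of the closed unit ball has a continuous left inverse `G`,
then the image of the ball is a neighbourhood of the point at which `G` vanishes. -/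
lemma image_closedBall_mem_nhds {f G : E → E} (hf : ContinuousOn f (closedBall 0 1))
    (hG : Continuous G) (hGf : ∀ x ∈ closedBall (0 : E) 1, G (f x) = x) :
    f 0 ∈ interior (f '' closedBall 0 1) := by
  rcases subsingleton_or_nontrivial E with hE | hE
  · have : f '' closedBall 0 1 = univ := by
      refine Subsingleton.eq_univ_of_nonempty ⟨f 0, mem_image_of_mem f (by simp)⟩
    rw [this, interior_univ]
    trivial
  let _ : MeasurableSpace E := borel E
  have : BorelSpace E := ⟨rfl⟩
  have hG0 : G (f 0) = 0 := hGf 0 (by simp)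
  obtain ⟨r, hr, hGr⟩ : ∃ r > 0, ∀ y, dist y (f 0) < 2 * r → ‖G y‖ < 1 / 10 := by
    obtain ⟨r, hr, h⟩ := Metric.continuous_iff.1 hG (f 0) (1 / 10) (by norm_num)
    refine ⟨r / 2, by positivity, fun y hy => ?_⟩
    have := h y (by linarith)
    rwa [hG0, dist_zero_right] at this
  refine mem_interior_iff_mem_nhds.2 (Metric.mem_nhds_iff.2 ⟨r, hr, fun c hc => ?_⟩)
  by_contra hcf
  have hK : IsCompact (f '' closedBall 0 1) := (isCompact_closedBall 0 1).image_of_continuousOn hf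
  set A : Set E := (f '' closedBall 0 1) ∩ {y | r ≤ dist y c} with hA
  have hAc : IsCompact A := hK.inter_right
    (isClosed_le continuous_const (continuous_id.dist continuous_const))
  have hGA : ∀ y ∈ A, G y ≠ 0 := by
    rintro y ⟨⟨x, hx, rfl⟩, hy⟩ h0
    rw [hGf x hx] at h0
    subst h0
    rw [mem_ofPred_eq, dist_comm] at hy
    exact absurd hc (not_lt.2 hy)
  obtain ⟨m, hm, hmA⟩ : ∃ m > 0, ∀ y ∈ A, m ≤ ‖G y‖ := by
    rcases A.eq_empty_or_nonempty with hA0 | hA0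
    · exact ⟨1, one_pos, by simp [hA0]⟩
    · obtain ⟨y, hy, hmin⟩ := hAc.exists_isMinOn hA0 hG.norm.continuousOn
      exact ⟨‖G y‖, norm_pos_iff.2 (hGA y hy), fun z hz => hmin hz⟩
  set η : ℝ := min (m / 3) (1 / 10) with hη
  have hη0 : 0 < η := by positivity
  obtain ⟨P, hP, hPG, -⟩ := hG.exists_contDiff_approx 1 (ε := fun _ => η) continuous_const
    (fun _ => hη0)
  have hPG' : ∀ y, ‖P y - G y‖ < η := fun y => by rw [← dist_eq_norm]; exact hPG y
  have hnull : (volume : Measure E) (P '' sphere c r) = 0 :=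
    addHaar_image_eq_zero_of_differentiableOn_of_addHaar_eq_zero _
      (hP.differentiable one_ne_zero).differentiableOn (Measure.addHaar_sphere _ _ _)
  obtain ⟨b, hbη, hb⟩ : ∃ b ∈ ball (0 : E) η, b ∉ P '' sphere c r := by
    by_contra! hsub
    exact (measure_ball_pos (volume : Measure E) 0 hη0).ne' (measure_mono_null hsub hnull)
  rw [mem_ball_zero_iff] at hbη
  set Φ : E → E := fun y => c + max (r / ‖y - c‖) 1 • (y - c) with hΦ
  have hfne : ∀ x ∈ closedBall (0 : E) 1, 0 < ‖f x - c‖ := fun x hx =>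
    norm_pos_iff.2 (sub_ne_zero.2 fun h => hcf ⟨x, hx, h⟩)
  have hΦc : ContinuousOn (fun x => Φ (f x)) (closedBall 0 1) := by
    have h1 : ContinuousOn (fun x => f x - c) (closedBall 0 1) := hf.sub continuousOn_const
    refine continuousOn_const.add (ContinuousOn.smul (ContinuousOn.sup
      (continuousOn_const.div h1.norm fun x hx => (hfne x hx).ne') continuousOn_const) h1)
  have hcase : ∀ x ∈ closedBall (0 : E) 1, (r ≤ ‖f x - c‖ ∧ Φ (f x) = f x) ∨
      (‖f x - c‖ < r ∧ Φ (f x) ∈ sphere c r) := by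
    intro x hx
    rcases le_or_gt r ‖f x - c‖ with h | h
    · refine Or.inl ⟨h, ?_⟩
      simp only [hΦ]
      rw [max_eq_right ((div_le_one (hfne x hx)).2 h), one_smul, add_sub_cancel]
    · refine Or.inr ⟨h, ?_⟩
      simp only [hΦ]
      rw [max_eq_left ((one_le_div (hfne x hx)).2 h.le), mem_sphere, dist_eq_norm,
        add_sub_cancel_left, norm_smul, Real.norm_of_nonneg (by positivity),
        div_mul_cancel₀ _ (hfne x hx).ne']
  obtain ⟨x, hx, hx0⟩ := exists_eq_zero_of_norm_sub_le (h := fun x => P (Φ (f x)) - b)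
    ((hP.continuous.comp_continuousOn hΦc).sub continuousOn_const) (by
      intro x hx
      rcases hcase x hx with ⟨h, h'⟩ | ⟨h, h'⟩
      · simp only [h']
        have h1 := hPG' (f x)
        rw [hGf x hx] at h1
        calc ‖P (f x) - b - x‖ = ‖(P (f x) - x) - b‖ := by congr 1; abel
          _ ≤ ‖P (f x) - x‖ + ‖b‖ := norm_sub_le _ _
          _ ≤ 1 / 2 := by linarith [min_le_right (m / 3) (1 / 10)]
      · have hd : dist c (f 0) < r := hc
        have h1 : ‖x‖ < 1 / 10 := by
          rw [← hGf x hx]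
          refine hGr _ ((dist_triangle _ c _).trans_lt ?_)
          rw [dist_eq_norm]
          linarith
        have h2 : ‖G (Φ (f x))‖ < 1 / 10 := by
          refine hGr _ ((dist_triangle _ c _).trans_lt ?_)
          rw [mem_sphere.1 h']
          linarith
        have h3 := hPG' (Φ (f x))
        calc ‖P (Φ (f x)) - b - x‖ = ‖(P (Φ (f x)) - G (Φ (f x))) + G (Φ (f x)) - b - x‖ := by
              congr 1; abel
          _ ≤ ‖P (Φ (f x)) - G (Φ (f x))‖ + ‖G (Φ (f x))‖ + ‖b‖ + ‖x‖ :=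
              (norm_sub_le _ _).trans (add_le_add_left ((norm_sub_le _ _).trans
                (add_le_add_left (norm_add_le _ _) _)) _)
          _ ≤ 1 / 2 := by linarith [min_le_right (m / 3) (1 / 10)])
  rw [sub_eq_zero] at hx0
  rcases hcase x hx with ⟨h, h'⟩ | ⟨h, h'⟩
  · rw [h'] at hx0
    have h1 := hmA (f x) ⟨mem_image_of_mem f hx, by rw [mem_ofPred_eq, dist_eq_norm]; exact h⟩
    have h2 := hPG' (f x)
    have h3 : ‖G (f x)‖ ≤ ‖P (f x) - G (f x)‖ + ‖P (f x)‖ := by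
      calc ‖G (f x)‖ = ‖P (f x) - (P (f x) - G (f x))‖ := by rw [sub_sub_cancel]
        _ ≤ _ := (norm_sub_le _ _).trans (add_comm _ _).le
    rw [hx0] at h3
    rw [hx0] at h2
    linarith [min_le_left (m / 3) (1 / 10 : ℝ)]
  · exact hb ⟨_, h', hx0⟩

/-- Invariance of domain, for closed balls. -/
theorem mem_interior_image_closedBall {f : E → E} {x : E} {R : ℝ} (hR : 0 < R)
    (hf : ContinuousOn f (closedBall x R)) (hinj : InjOn f (closedBall x R)) :
    f x ∈ interior (f '' closedBall x R) := by
  set a : E → E := fun y => x + R • y with ha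
  have hac : Continuous a := by fun_prop
  have haimg : a '' closedBall 0 1 = closedBall x R := by
    have := smul_unitClosedBall_of_nonneg (E := E) hR.le
    have h2 : a = (fun y => x + y) ∘ fun y => R • y := rfl
    rw [h2, image_comp, Set.image_smul, this, image_add_left]
    ext y
    simp [dist_eq_norm, sub_eq_neg_add]
  have hmaps : MapsTo a (closedBall 0 1) (closedBall x R) := fun y hy => by
    rw [← haimg]; exact mem_image_of_mem a hy
  have hainj : Function.Injective a := fun y z h => by
    simpa [ha, hR.ne'] using h
  have hfa : ContinuousOn (f ∘ a) (closedBall 0 1) := hf.comp hac.continuousOn hmaps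
  have hfainj : InjOn (f ∘ a) (closedBall 0 1) := hinj.comp hainj.injOn hmaps
  have hcpt : CompactSpace (closedBall (0 : E) 1) :=
    isCompact_iff_compactSpace.1 (isCompact_closedBall 0 1)
  have hemb : Topology.IsClosedEmbedding (fun y : closedBall (0 : E) 1 => (f ∘ a) y) :=
    Continuous.isClosedEmbedding (continuousOn_iff_continuous_domRestrict.1 hfa)
      (injOn_iff_injective.1 hfainj)
  obtain ⟨G, hG⟩ := ContinuousMap.exists_extension (Y := E) hemb
    (⟨Subtype.val, continuous_subtype_val⟩ : C(closedBall (0 : E) 1, E))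
  have key := image_closedBall_mem_nhds hfa G.continuous (fun y hy =>
    congrArg (fun g : C(closedBall (0 : E) 1, E) => g ⟨y, hy⟩) hG)
  rw [image_comp, haimg] at key
  simpa [ha] using key

/-- If `f` is continuous and injective on a ball, then the image of this ball contains every ball
around the image of the centre which does not meet the image of the boundary sphere. -/
theorem closedBall_subset_image_closedBall {f : E → E} {x : E} {R τ : ℝ} (hR : 0 < R)
    (hτ : 0 ≤ τ) (hf : ContinuousOn f (closedBall x R)) (hinj : InjOn f (closedBall x R))
    (hsph : ∀ b ∈ sphere x R, τ < dist (f b) (f x)) :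
    closedBall (f x) τ ⊆ f '' closedBall x R := by
  have hopen : IsOpen (f '' ball x R) := by
    rw [isOpen_iff_mem_nhds]
    rintro _ ⟨y, hy, rfl⟩
    obtain ⟨s, hs, hsub⟩ := Metric.isOpen_iff.1 isOpen_ball y hy
    have hsub' : closedBall y (s / 2) ⊆ ball x R :=
      (closedBall_subset_ball (half_lt_self hs)).trans hsub
    have := mem_interior_image_closedBall (half_pos hs)
      (hf.mono (hsub'.trans ball_subset_closedBall))
      (hinj.mono (hsub'.trans ball_subset_closedBall))
    exact mem_of_superset (mem_interior_iff_mem_nhds.1 this) (image_mono hsub')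
  have hclosed : IsClosed (f '' closedBall x R) :=
    ((isCompact_closedBall x R).image_of_continuousOn hf).isClosed
  have hpre : IsPreconnected (closedBall (f x) τ) := (convex_closedBall _ _).isPreconnected
  by_contra hns
  obtain ⟨z, hz, hzn⟩ := not_subset.1 hns
  obtain ⟨w, hw, hw1, hw2⟩ := hpre _ _ hopen hclosed.isOpen_compl (by
      intro w hw
      by_cases h : w ∈ f '' closedBall x R
      · left
        obtain ⟨y, hy, rfl⟩ := h
        rcases (mem_closedBall.1 hy).lt_or_eq with h | h
        · exact mem_image_of_mem f h
        · exact absurd (hsph y h) (not_lt.2 hw)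
      · exact Or.inr h)
    ⟨f x, mem_closedBall_self hτ, mem_image_of_mem f (mem_ball_self hR)⟩ ⟨z, hz, hzn⟩
  exact hw2 (image_mono ball_subset_closedBall hw1)

end InvarianceOfDomain

section Modulus

lemma one_le_log_one_div {t : ℝ} (ht : 0 < t) (ht' : t ≤ Real.exp (-1)) :
    1 ≤ Real.log (1 / t) := by
  rw [Real.le_log_iff_exp_le (by positivity), le_div_iff₀ ht]
  calc Real.exp 1 * t ≤ Real.exp 1 * Real.exp (-1) :=
        mul_le_mul_of_nonneg_left ht' (Real.exp_nonneg _)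
    _ = 1 := by rw [← Real.exp_add]; simp

lemma mul_log_rpow_le_mul_log_rpow {α u r t : ℝ} (hα0 : 0 ≤ α) (hα1 : α ≤ 1) (hu : 0 < u)
    (hut : u ≤ t) (hr : 0 < r) (hrt : r ≤ t) (ht : t < Real.exp (-1)) :
    u * Real.log (1 / u) ^ α ≤ t * Real.log (1 / r) ^ α := by
  have ht0 : 0 < t := hu.trans_le hut
  have hl2 := one_le_log_one_div ht0 ht.le
  have hlu : Real.log (1 / t) ≤ Real.log (1 / u) :=
    Real.log_le_log (by positivity) (one_div_le_one_div_of_le hu hut)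
  have hlr : Real.log (1 / t) ≤ Real.log (1 / r) :=
    Real.log_le_log (by positivity) (one_div_le_one_div_of_le hr hrt)
  have hexp : ∀ s, 0 < s → s ≤ t → Real.exp 1 ≤ 1 / s := fun s hs hst => by
    rw [← Real.le_log_iff_exp_le (by positivity)]
    exact one_le_log_one_div hs (hst.trans ht.le)
  have hanti := Real.log_div_self_antitoneOn (hexp t ht0 le_rfl) (hexp u hu hut)
    (one_div_le_one_div_of_le hu hut)
  simp only [div_div_eq_mul_div, div_one] at hanti
  set l := Real.log (1 / t)
  set l' := Real.log (1 / u)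
  have hl0 : 0 < l := by linarith
  have hq : 1 ≤ l' / l := (one_le_div hl0).2 hlu
  calc u * l' ^ α = u * ((l' / l) ^ α * l ^ α) := by
        rw [← Real.mul_rpow (by positivity) hl0.le, div_mul_cancel₀ _ hl0.ne']
    _ ≤ u * ((l' / l) ^ (1 : ℝ) * l ^ α) := by
        gcongr
    _ = (l' * u) / l * l ^ α := by rw [Real.rpow_one]; ring
    _ ≤ t * l ^ α := by
        gcongr
        rw [div_le_iff₀ hl0]
        linarith
    _ ≤ t * Real.log (1 / r) ^ α := by gcongr

lemma le_mul_of_le_modulus {α K A B r t : ℝ} (hα0 : 0 ≤ α) (hα1 : α ≤ 1) (hK : 0 ≤ K)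
    (h : 0 < A → A < Real.exp (-1) → B ≤ K * (A * Real.log (1 / A) ^ α)) (hA : 0 ≤ A)
    (h0 : A = 0 → B = 0) (hAt : A ≤ t) (hr : 0 < r) (hrt : r ≤ t) (ht : t < Real.exp (-1)) :
    B ≤ K * Real.log (1 / r) ^ α * t := by
  rcases hA.eq_or_lt with hA | hA
  · rw [h0 hA.symm]
    have := one_le_log_one_div hr (hrt.trans ht.le)
    have : 0 < t := hr.trans_le hrt
    positivity
  · refine (h hA (hAt.trans_lt ht)).trans ?_
    rw [mul_assoc, mul_comm _ t]
    exact mul_le_mul_of_nonneg_left (mul_log_rpow_le_mul_log_rpow hα0 hα1 hA hAt hr hrt ht) hK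

lemma continuousOn_of_modulus {X Y : Type*} [PseudoMetricSpace X] [PseudoMetricSpace Y]
    {f : X → Y} {s : Set X} {α K : ℝ} (hα1 : α ≤ 1) (hK : 0 ≤ K)
    (hX : ∀ x y : X, dist x y = 0 → dist (f x) (f y) = 0)
    (h : ∀ x ∈ s, ∀ y ∈ s, 0 < dist x y → dist x y < Real.exp (-1) →
      dist (f x) (f y) ≤ K * (dist x y * Real.log (1 / dist x y) ^ α)) : ContinuousOn f s := by
  refine Metric.continuousOn_iff.2 fun b hb ε hε => ?_
  have hlim : Tendsto (fun t : ℝ => K * Real.negMulLog t) (nhds 0) (nhds 0) := by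
    have := (Real.continuous_negMulLog.tendsto 0).const_mul K
    simpa using this
  obtain ⟨δ, hδ, hlt⟩ := Metric.eventually_nhds_iff.1 (hlim.eventually (gt_mem_nhds hε))
  refine ⟨min δ (Real.exp (-1)), lt_min hδ (Real.exp_pos _), fun a ha hab => ?_⟩
  rcases (dist_nonneg (x := a) (y := b)).eq_or_lt with h0 | h0
  · rw [hX a b h0.symm]; exact hε
  have h1 : dist a b < Real.exp (-1) := hab.trans_le (min_le_right _ _)
  have hl := one_le_log_one_div h0 h1.le
  refine (h a ha b hb h0 h1).trans_lt (lt_of_le_of_lt ?_ (hlt (y := dist a b) ?_))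
  · refine mul_le_mul_of_nonneg_left ?_ hK
    rw [Real.negMulLog, neg_mul, ← mul_neg, ← Real.log_inv, ← one_div]
    refine mul_le_mul_of_nonneg_left ?_ h0.le
    calc Real.log (1 / dist a b) ^ α ≤ Real.log (1 / dist a b) ^ (1 : ℝ) :=
          Real.rpow_le_rpow_of_exponent_le hl hα1
      _ = _ := Real.rpow_one _
  · rw [dist_zero_right, Real.norm_of_nonneg dist_nonneg]
    exact hab.trans_le (min_le_left _ _)

end Modulus

section Energy

variable {E : Type*} [NormedAddCommGroup E]

/-- The increment of `F` over the `i`-th interval of length `r`. -/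
def increment (F : ℝ → E) (r : ℝ) (i : ℕ) : E := F ((i + 1 : ℕ) * r) - F (i * r)

lemma sum_increment (F : ℝ → E) (r : ℝ) (m n : ℕ) :
    ∑ l ∈ Finset.range n, increment F r (m + l) = F ((m + n : ℕ) * r) - F (m * r) :=
  Finset.sum_range_sub (fun l => F ((m + l : ℕ) * r)) n

lemma sum_increment_div (F : ℝ → E) {R : ℕ} (hR : 0 < R) (r : ℝ) (i : ℕ) :
    ∑ l ∈ Finset.range R, increment F (r / R) (i * R + l) = increment F r i := by
  have hR' : (R : ℝ) ≠ 0 := by positivity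
  rw [sum_increment, increment]
  congr 2 <;> push_cast <;> field_simp

variable [InnerProductSpace ℝ E]

/-- The squared deviation of the `R` sub-increments from their mean. -/
def incrementVariance (F : ℝ → E) (R : ℕ) (r : ℝ) (i : ℕ) : ℝ :=
  ∑ l ∈ Finset.range R,
    ‖increment F (r / R) (i * R + l) - (R : ℝ)⁻¹ • increment F r i‖ ^ 2

lemma incrementVariance_nonneg (F : ℝ → E) (R : ℕ) (r : ℝ) (i : ℕ) :
    0 ≤ incrementVariance F R r i := Finset.sum_nonneg fun _ _ => sq_nonneg _

lemma sum_range_mul_eq (f : ℕ → ℝ) (n R : ℕ) :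
    ∑ i ∈ Finset.range (n * R), f i =
      ∑ i ∈ Finset.range n, ∑ l ∈ Finset.range R, f (i * R + l) := by
  induction n with
  | zero => simp
  | succ n ih => rw [add_mul, one_mul, Finset.sum_range_add, ih, Finset.sum_range_succ]

lemma incrementVariance_eq (F : ℝ → E) {R : ℕ} (hR : 0 < R) (r : ℝ) (i : ℕ) :
    incrementVariance F R r i =
      (∑ l ∈ Finset.range R, ‖increment F (r / R) (i * R + l)‖ ^ 2) -
        (R : ℝ)⁻¹ * ‖increment F r i‖ ^ 2 := by
  have hR' : (R : ℝ) ≠ 0 := by positivity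
  simp_rw [incrementVariance, norm_sub_sq_real, inner_smul_right]
  rw [Finset.sum_add_distrib, Finset.sum_sub_distrib, ← Finset.mul_sum, ← Finset.mul_sum,
    ← sum_inner, sum_increment_div F hR, real_inner_self_eq_norm_sq, Finset.sum_const,
    Finset.card_range, norm_smul, norm_inv, RCLike.norm_natCast, nsmul_eq_mul]
  field_simp
  ring

/-- The total of the normalized variances over all scales is controlled by the finest scale. -/
lemma sum_incrementVariance_le (F : ℝ → E) {R : ℕ} (hR : 0 < R) (r : ℝ) (M : ℕ) :
    ∑ j ∈ Finset.range M, (R : ℝ) ^ (j + 1) *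
        ∑ i ∈ Finset.range (R ^ j), incrementVariance F R (r / R ^ j) i ≤
      (R : ℝ) ^ M * ∑ i ∈ Finset.range (R ^ M), ‖increment F (r / R ^ M) i‖ ^ 2 := by
  have hR' : (R : ℝ) ≠ 0 := by positivity
  have hstep : ∀ j : ℕ, (R : ℝ) ^ (j + 1) *
        ∑ i ∈ Finset.range (R ^ j), incrementVariance F R (r / R ^ j) i =
      (R : ℝ) ^ (j + 1) * ∑ i ∈ Finset.range (R ^ (j + 1)), ‖increment F (r / R ^ (j + 1)) i‖ ^ 2 -
      (R : ℝ) ^ j * ∑ i ∈ Finset.range (R ^ j), ‖increment F (r / R ^ j) i‖ ^ 2 := by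
    intro j
    simp_rw [incrementVariance_eq F hR]
    rw [Finset.sum_sub_distrib, ← Finset.mul_sum, mul_sub, div_div, ← pow_succ]
    congr 1
    · congr 1
      rw [pow_succ R j, sum_range_mul_eq]
    · rw [pow_succ, mul_assoc, mul_inv_cancel_left₀ hR']
  rw [Finset.sum_congr rfl fun j _ => hstep j, Finset.sum_range_sub
    (fun j => (R : ℝ) ^ j * ∑ i ∈ Finset.range (R ^ j), ‖increment F (r / R ^ j) i‖ ^ 2)]
  exact sub_le_self _ (by positivity)

end Energy

section Selection

variable {M : ℕ} {V : Type*} [Fintype V]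

/-- The digit sequence which agrees with `a` at the positions below `j` and with `b` elsewhere. -/
def mixDigits (j : ℕ) (a b : Fin M → V) : Fin M → V := fun k => if (k : ℕ) < j then a k else b k

lemma sum_sum_mixDigits (j : ℕ) (g : (Fin M → V) → ℝ) :
    ∑ a, ∑ b, g (mixDigits j a b) = (Fintype.card V : ℝ) ^ M * ∑ a, g a := by
  classical
  have hinv : Function.Involutive
      (fun q : (Fin M → V) × (Fin M → V) => (mixDigits j q.1 q.2, mixDigits j q.2 q.1)) := by
    rintro ⟨a, b⟩
    ext k <;> simp only [mixDigits] <;> split_ifs <;> rfl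
  rw [← Fintype.sum_prod_type' (f := fun a b => g (mixDigits j a b))]
  rw [Fintype.sum_equiv hinv.toPerm (fun q => g (mixDigits j q.1 q.2)) (fun q => g q.1)
    (fun q => rfl), Fintype.sum_prod_type]
  simp [Finset.mul_sum]

lemma sum_update_le [DecidableEq V] (j : Fin M) (v : V) (g : (Fin M → V) → ℝ)
    (hg : ∀ b, 0 ≤ g b) :
    ∑ b, g (Function.update b j v) ≤ (Fintype.card V : ℝ) * ∑ b, g b := by
  classical
  have hinv : Function.Involutive
      (fun q : (Fin M → V) × V => (Function.update q.1 j q.2, q.1 j)) := by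
    rintro ⟨a, b⟩
    simp
  calc ∑ b, g (Function.update b j v)
      ≤ ∑ b, ∑ u, g (Function.update b j u) := by
        refine Finset.sum_le_sum fun b _ => ?_
        exact Finset.single_le_sum (f := fun u => g (Function.update b j u)) (fun u _ => hg _)
          (Finset.mem_univ v)
    _ = (Fintype.card V : ℝ) * ∑ b, g b := by
        rw [← Fintype.sum_prod_type' (f := fun b u => g (Function.update b j u))]
        rw [Fintype.sum_equiv hinv.toPerm (fun q => g (Function.update q.1 j q.2))
          (fun q => g q.1) (fun q => rfl), Fintype.sum_prod_type]
        simp [Finset.mul_sum]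

/-- The index set of the cells: a scale, a digit sequence and a position on the line. -/
abbrev CellIndex (M R : ℕ) (V : Type*) : Type _ :=
  (j : Fin M) × (Fin M → V) × Fin (R ^ (j : ℕ))

/-- The weight of a cell. -/
def cellWeight {R : ℕ} (n : CellIndex M R V) : ℝ := ((R : ℝ) ^ (n.1 : ℕ))⁻¹

lemma sum_cellWeight {R : ℕ} (hR : 0 < R) :
    ∑ n : CellIndex M R V, cellWeight n = M * (Fintype.card V : ℝ) ^ M := by
  classical
  have hR' : (R : ℝ) ≠ 0 := by positivity
  simp [cellWeight, Fintype.sum_sigma, hR']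

variable {R : ℕ} {E : Type*} [NormedAddCommGroup E] [InnerProductSpace ℝ E]

/-- Pigeonhole selection of a cell at which all the lines have nearly constant increments and at
which a given nonnegative error is not larger than twice its average. -/
theorem exists_good_cell [DecidableEq V] [Nonempty V] (hR : 0 < R) (hM : 0 < M)
    (F : (Fin M → V) → ℝ → E) {r L : ℝ} (hr : 0 < r) (hL : 0 < L)
    (hF : ∀ a, ∀ i < R ^ M, ‖increment (F a) (r / R ^ M) i‖ ≤ L * (r / R ^ M))
    (φ : CellIndex M R V → ℝ) (hφ : ∀ n, 0 ≤ φ n) {e : ℝ} (he : 0 < e)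
    (hφe : ∑ n, cellWeight n * φ n ≤ M * (Fintype.card V : ℝ) ^ M * e) :
    ∃ n : CellIndex M R V, φ n ≤ 2 * e ∧ ∀ v : V, ∃ c : Fin M → V,
      (∀ k : Fin M, (k : ℕ) < n.1 → c k = n.2.1 k) ∧ c n.1 = v ∧
      incrementVariance (F c) R (r / R ^ (n.1 : ℕ)) n.2.2 ≤
        2 * L ^ 2 * (Fintype.card V : ℝ) / (M * R) * (r / R ^ (n.1 : ℕ)) ^ 2 := by
  classical
  have hR' : (0 : ℝ) < R := by positivity
  have hM' : (0 : ℝ) < M := by positivity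
  have hV : (0 : ℝ) < Fintype.card V := by exact_mod_cast Fintype.card_pos
  set N : ℝ := (Fintype.card V : ℝ) ^ M with hN
  have hN0 : 0 < N := by positivity
  set W : (Fin M → V) → (j : ℕ) → ℕ → ℝ := fun c j i => incrementVariance (F c) R (r / R ^ j) i
  have hW0 : ∀ c j i, 0 ≤ W c j i := fun c j i => incrementVariance_nonneg _ _ _ _
  set X : CellIndex M R V → ℝ := fun n =>
    (R : ℝ) ^ (2 * (n.1 : ℕ) + 1) * (N⁻¹ * ∑ b, W (mixDigits n.1 n.2.1 b) n.1 n.2.2) with hX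
  have hXsum : ∑ n, cellWeight n * X n ≤ N * (L ^ 2 * r ^ 2) := by
    have h1 : ∑ n, cellWeight n * X n =
        ∑ c, ∑ j ∈ Finset.range M, (R : ℝ) ^ (j + 1) * ∑ i ∈ Finset.range (R ^ j), W c j i := by
      rw [Finset.sum_comm, Fintype.sum_sigma, Finset.sum_range]
      refine Finset.sum_congr rfl fun j _ => ?_
      rw [← Finset.mul_sum, Fintype.sum_prod_type]
      calc ∑ a, ∑ i : Fin (R ^ (j : ℕ)), cellWeight (⟨j, a, i⟩ : CellIndex M R V) * X ⟨j, a, i⟩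
          = ∑ a, ∑ i : Fin (R ^ (j : ℕ)), (R : ℝ) ^ ((j : ℕ) + 1) * N⁻¹ *
              ∑ b, W (mixDigits j a b) j i := by
            refine Finset.sum_congr rfl fun a _ => Finset.sum_congr rfl fun i _ => ?_
            simp only [cellWeight, hX]
            field_simp
            ring
        _ = (R : ℝ) ^ ((j : ℕ) + 1) * N⁻¹ * ∑ a, ∑ b, ∑ i : Fin (R ^ (j : ℕ)),
              W (mixDigits j a b) j i := by
            rw [Finset.mul_sum]
            refine Finset.sum_congr rfl fun a _ => ?_
            rw [← Finset.mul_sum, Finset.sum_comm]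
        _ = (R : ℝ) ^ ((j : ℕ) + 1) * ∑ c, ∑ i : Fin (R ^ (j : ℕ)), W c j i := by
            rw [sum_sum_mixDigits (j : ℕ) (fun c => ∑ i : Fin (R ^ (j : ℕ)), W c j i), ← hN]
            field_simp
        _ = _ := by
            congr 1
            refine Finset.sum_congr rfl fun c _ => ?_
            rw [Finset.sum_range]
    rw [h1]
    calc _ ≤ ∑ c : Fin M → V, L ^ 2 * r ^ 2 := by
          refine Finset.sum_le_sum fun c _ => (sum_incrementVariance_le (F c) hR r M).trans ?_
          calc (R : ℝ) ^ M * ∑ i ∈ Finset.range (R ^ M), ‖increment (F c) (r / R ^ M) i‖ ^ 2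
              ≤ (R : ℝ) ^ M * ∑ i ∈ Finset.range (R ^ M), (L * (r / R ^ M)) ^ 2 := by
                gcongr with i hi
                exact hF c i (Finset.mem_range.1 hi)
            _ = L ^ 2 * r ^ 2 := by
                rw [Finset.sum_const, Finset.card_range, nsmul_eq_mul]
                push_cast
                field_simp
      _ = N * (L ^ 2 * r ^ 2) := by
          rw [Finset.sum_const, nsmul_eq_mul, Finset.card_univ, Fintype.card_fun,
            Fintype.card_fin]
          push_cast
          rfl
  have hX0 : ∀ n, 0 ≤ X n := fun n =>
    mul_nonneg (by positivity) (mul_nonneg (by positivity) (Finset.sum_nonneg fun _ _ => hW0 _ _ _))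
  obtain ⟨n, hn⟩ : ∃ n : CellIndex M R V, X n * M / (L ^ 2 * r ^ 2) + φ n / e ≤ 2 := by
    by_contra! hlt
    have hne : Nonempty (CellIndex M R V) :=
      ⟨⟨⟨0, hM⟩, Classical.arbitrary _, ⟨0, by positivity⟩⟩⟩
    have h1 : ∑ n : CellIndex M R V, cellWeight n * 2 <
        ∑ n, cellWeight n * (X n * M / (L ^ 2 * r ^ 2) + φ n / e) :=
      Finset.sum_lt_sum_of_nonempty Finset.univ_nonempty fun n _ =>
        mul_lt_mul_of_pos_left (hlt n) (by unfold cellWeight; positivity)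
    rw [← Finset.sum_mul, sum_cellWeight hR, ← hN] at h1
    have h2 : ∑ n, cellWeight n * (X n * M / (L ^ 2 * r ^ 2) + φ n / e) =
        (M / (L ^ 2 * r ^ 2)) * (∑ n, cellWeight n * X n) + e⁻¹ * ∑ n, cellWeight n * φ n := by
      rw [Finset.mul_sum, Finset.mul_sum, ← Finset.sum_add_distrib]
      refine Finset.sum_congr rfl fun n _ => ?_
      ring
    have h3 : (M / (L ^ 2 * r ^ 2)) * (∑ n, cellWeight n * X n) ≤ M * N := by
      calc _ ≤ (M / (L ^ 2 * r ^ 2)) * (N * (L ^ 2 * r ^ 2)) := by gcongr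
        _ = M * N := by field_simp
    have h4 : e⁻¹ * ∑ n, cellWeight n * φ n ≤ M * N := by
      calc _ ≤ e⁻¹ * (M * N * e) := by gcongr
        _ = M * N := by field_simp
    linarith
  have hXn : X n * M / (L ^ 2 * r ^ 2) ≤ 2 := by
    have := div_nonneg (hφ n) he.le
    linarith
  have hφn : φ n / e ≤ 2 := by
    have : 0 ≤ X n * M / (L ^ 2 * r ^ 2) :=
      div_nonneg (mul_nonneg (hX0 n) hM'.le) (by positivity)
    linarith
  refine ⟨n, by rwa [div_le_iff₀ he] at hφn, fun v => ?_⟩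
  obtain ⟨j, a, i⟩ := n
  simp only [hX] at hXn
  have h1 := sum_update_le j v (fun b => W (mixDigits j a b) j i) (fun b => hW0 _ _ _)
  have hcard : ∑ _b : Fin M → V, (Fintype.card V : ℝ) *
      (N⁻¹ * ∑ b, W (mixDigits j a b) j i) = Fintype.card V * ∑ b, W (mixDigits j a b) j i := by
    rw [Finset.sum_const, nsmul_eq_mul, Finset.card_univ, Fintype.card_fun, Fintype.card_fin]
    push_cast
    rw [← hN]
    field_simp
  rw [← hcard] at h1
  obtain ⟨b, -, hb⟩ := Finset.exists_le_of_sum_le Finset.univ_nonempty h1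
  refine ⟨mixDigits j a (Function.update b j v), fun k hk => if_pos hk, ?_, hb.trans ?_⟩
  · simp [mixDigits]
  · rw [div_le_iff₀ (by positivity)] at hXn
    have hRj : (0 : ℝ) < R ^ (j : ℕ) := by positivity
    rw [pow_succ, pow_mul'] at hXn
    set T := N⁻¹ * ∑ b, W (mixDigits j a b) j i
    calc (Fintype.card V : ℝ) * T
        = Fintype.card V / (M * R * (R ^ (j : ℕ)) ^ 2) * ((R ^ (j : ℕ)) ^ 2 * R * T * M) := by
          field_simp
      _ ≤ Fintype.card V / (M * R * (R ^ (j : ℕ)) ^ 2) * (2 * (L ^ 2 * r ^ 2)) := by gcongr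
      _ = _ := by field_simp

end Selection

section Digits

/-- The length scales: each is smaller than the previous one by the factor `S ^ 2`. -/
def stepLen (S : ℕ) (r : ℝ) (j : ℕ) : ℝ := r / ((S ^ 2 : ℕ) : ℝ) ^ j

variable {S : ℕ} {r : ℝ}

lemma stepLen_pos (hS : 0 < S) (hr : 0 < r) (j : ℕ) : 0 < stepLen S r j := by
  unfold stepLen; positivity

lemma stepLen_succ_mul (hS : 0 < S) (j : ℕ) :
    stepLen S r (j + 1) * (S : ℝ) ^ 2 = stepLen S r j := by
  have : (S : ℝ) ≠ 0 := by positivity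
  unfold stepLen
  push_cast
  field_simp
  ring

lemma stepLen_zero : stepLen S r 0 = r := by simp [stepLen]

lemma stepLen_anti (hS : 0 < S) (hr : 0 < r) : Antitone (stepLen S r) := by
  refine antitone_nat_of_succ_le fun n => ?_
  have h1 : (1 : ℝ) ≤ S := by exact_mod_cast hS
  rw [← stepLen_succ_mul hS n]
  exact le_mul_of_one_le_right (stepLen_pos hS hr _).le (one_le_pow₀ h1)

lemma sum_digits_add_le (hS : 0 < S) (hr : 0 < r) {b : ℕ → ℕ} (hb : ∀ l, b l < S) {k j : ℕ}
    (hkj : k ≤ j) : ∑ l ∈ Finset.Ico k j, (b l : ℝ) * stepLen S r (l + 1) + stepLen S r j / S ≤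
      stepLen S r k / S := by
  induction j, hkj using Nat.le_induction with
  | base => simp
  | succ n hkn ih =>
    rw [Finset.sum_Ico_succ_top hkn]
    refine le_trans ?_ ih
    rw [add_assoc]
    refine add_le_add_right ?_ _
    have h1 : (1 : ℝ) ≤ S := by exact_mod_cast hS
    have h2 : (b n : ℝ) + 1 ≤ S := by exact_mod_cast hb n
    have h3 := stepLen_pos hS hr (n + 1)
    have h4 : stepLen S r n / S = stepLen S r (n + 1) * S := by
      rw [← stepLen_succ_mul hS n]
      field_simp
    rw [h4]
    have h5 : stepLen S r (n + 1) / S ≤ stepLen S r (n + 1) := div_le_self h3.le h1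
    nlinarith

lemma exists_sum_digits_eq (hS : 0 < S) (b : ℕ → ℕ) (n : ℕ) :
    ∃ N : ℕ, ∑ l ∈ Finset.range n, (b l : ℝ) * stepLen S r (l + 1) = N * stepLen S r n := by
  induction n with
  | zero => exact ⟨0, by simp⟩
  | succ n ih =>
    obtain ⟨N, hN⟩ := ih
    refine ⟨N * S ^ 2 + b n, ?_⟩
    rw [Finset.sum_range_succ, hN, ← stepLen_succ_mul hS n]
    push_cast
    ring

lemma fract_div_of_eq {z r y : ℝ} {N : ℕ} (hr : 0 < r) (hz : z = N * r + y) (hy0 : 0 ≤ y)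
    (hyr : y < r) : Int.fract (z / r) = y / r := by
  rw [hz, add_div, mul_div_assoc, div_self hr.ne', mul_one, Int.fract_natCast_add,
    Int.fract_eq_self.2 ⟨by positivity, (div_lt_one hr).2 hyr⟩]

end Digits

section Oscillation

variable {d : ℕ}

/-- The points whose transversal coordinates are slightly above the grid of mesh `stepLen S r j`. -/
def thinSet (i₀ : Fin d) (S : ℕ) (r : ℝ) (j : ℕ) : Set (Euc d) :=
  {z | ∀ k, k ≠ i₀ → Int.fract (z k / stepLen S r j) < 1 / S}

/-- The sign pattern at scale `j` in the direction `i₀`. -/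
def signAt (i₀ : Fin d) (S : ℕ) (r : ℝ) (j : ℕ) (z : Euc d) : ℝ :=
  if Int.fract (z i₀ / stepLen S r j) < 1 / S then 1 else -1

open scoped Classical in
/-- The oscillating density: at scale `j` it is given by `signAt` outside of `thinSet`, and on
`thinSet` the construction continues at the following scale. -/
def multiscaleSign (i₀ : Fin d) (S : ℕ) (r : ℝ) : ℕ → ℕ → Euc d → ℝ
  | 0, j, z => signAt i₀ S r j z
  | m + 1, j, z =>
    if z ∈ thinSet i₀ S r (j + 1) then multiscaleSign i₀ S r m (j + 1) z else signAt i₀ S r j z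

variable {i₀ : Fin d} {S : ℕ} {r : ℝ}

lemma measurable_coord (k : Fin d) : Measurable fun z : Euc d => z k :=
  (EuclideanSpace.proj (𝕜 := ℝ) k).continuous.measurable

lemma measurableSet_thinSet (j : ℕ) : MeasurableSet (thinSet i₀ S r j) := by
  have : thinSet i₀ S r j = ⋂ k : Fin d, ⋂ _ : k ≠ i₀,
      {z : Euc d | Int.fract (z k / stepLen S r j) < 1 / S} := by
    ext z; simp [thinSet]
  rw [this]
  refine MeasurableSet.iInter fun k => MeasurableSet.iInter fun _ => ?_
  exact measurableSet_lt (((measurable_coord k).div_const _).fract) measurable_const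

lemma measurable_signAt (j : ℕ) : Measurable (signAt i₀ S r j) :=
  Measurable.ite (measurableSet_lt (((measurable_coord i₀).div_const _).fract) measurable_const)
    measurable_const measurable_const

lemma measurable_multiscaleSign (m j : ℕ) : Measurable (multiscaleSign i₀ S r m j) := by
  classical
  induction m generalizing j with
  | zero => exact measurable_signAt j
  | succ m ih => exact Measurable.ite (measurableSet_thinSet _) (ih _) (measurable_signAt j)

lemma abs_signAt (j : ℕ) (z : Euc d) : |signAt i₀ S r j z| = 1 := by
  unfold signAt; split_ifs <;> simp

lemma abs_multiscaleSign (m j : ℕ) (z : Euc d) : |multiscaleSign i₀ S r m j z| = 1 := by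
  induction m generalizing j with
  | zero => exact abs_signAt j z
  | succ m ih =>
    unfold multiscaleSign
    split_ifs
    · exact ih _
    · exact abs_signAt j z

lemma multiscaleSign_add (m n j : ℕ) (z : Euc d)
    (h : ∀ l, j < l → l ≤ j + n → z ∈ thinSet i₀ S r l) :
    multiscaleSign i₀ S r (m + n) j z = multiscaleSign i₀ S r m (j + n) z := by
  induction n generalizing j with
  | zero => rfl
  | succ n ih =>
    rw [← add_assoc, multiscaleSign, if_pos (h _ (by omega) (by omega)),
      ih (j + 1) fun l h1 h2 => h l (by omega) (by omega)]
    congr 1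
    omega

lemma multiscaleSign_eq_signAt {M j : ℕ} (hj : j < M) {z : Euc d}
    (h : ∀ l, 0 < l → l ≤ j → z ∈ thinSet i₀ S r l) (h' : z ∉ thinSet i₀ S r (j + 1)) :
    multiscaleSign i₀ S r M 0 z = signAt i₀ S r j z := by
  obtain ⟨m, rfl⟩ : ∃ m, M = m + 1 + j := ⟨M - 1 - j, by omega⟩
  rw [multiscaleSign_add (m + 1) j 0 z fun l h1 h2 => h l h1 (by omega), zero_add, multiscaleSign,
    if_neg h']

variable {M : ℕ}

/-- The `l`-th digit in the direction `k`. -/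
def digit (c : Fin M → Fin d → Fin S) (k : Fin d) (l : ℕ) : ℕ :=
  if h : l < M then c ⟨l, h⟩ k else 0

lemma digit_lt (hS : 0 < S) (c : Fin M → Fin d → Fin S) (k : Fin d) (l : ℕ) :
    digit c k l < S := by
  unfold digit
  split_ifs
  · exact (c _ k).2
  · exact hS

/-- The transversal offset given by the digits below `j`. -/
def digitOffset (i₀ : Fin d) (r : ℝ) (c : Fin M → Fin d → Fin S) (j : ℕ) : Euc d :=
  WithLp.toLp 2 fun k =>
    if k = i₀ then 0 else ∑ l ∈ Finset.range j, (digit c k l : ℝ) * stepLen S r (l + 1)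

lemma digitOffset_apply_self (c : Fin M → Fin d → Fin S) (j : ℕ) :
    digitOffset i₀ r c j i₀ = 0 := if_pos rfl

lemma digitOffset_apply (c : Fin M → Fin d → Fin S) (j : ℕ) {k : Fin d} (hk : k ≠ i₀) :
    digitOffset i₀ r c j k =
      ∑ l ∈ Finset.range j, (digit c k l : ℝ) * stepLen S r (l + 1) := if_neg hk

/-- The half open cube of side `s`. -/
def halfOpenCube (d : ℕ) (s : ℝ) : Set (Euc d) := {u | ∀ k, u k ∈ Ico 0 s}

lemma mem_thinSet_of_mem_cell (hS : 0 < S) (hr : 0 < r) (c : Fin M → Fin d → Fin S) {j l : ℕ}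
    (hlj : l ≤ j) {u : Euc d} (hu : u ∈ halfOpenCube d (stepLen S r j / S)) (t : ℝ) :
    digitOffset i₀ r c j + t • EuclideanSpace.single i₀ (1 : ℝ) + u ∈ thinSet i₀ S r l := by
  intro k hk
  have hz : (digitOffset i₀ r c j + t • EuclideanSpace.single i₀ (1 : ℝ) + u) k =
      digitOffset i₀ r c j k + u k := by
    simp [hk]
  have hSR : (0 : ℝ) < S := by positivity
  have hl := stepLen_pos hS hr l
  obtain ⟨N, hN⟩ := exists_sum_digits_eq (r := r) hS (digit c k) l
  have hle := sum_digits_add_le hS hr (digit_lt hS c k) hlj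
  have h0 : 0 ≤ ∑ l ∈ Finset.Ico l j, (digit c k l : ℝ) * stepLen S r (l + 1) :=
    Finset.sum_nonneg fun i _ => mul_nonneg (Nat.cast_nonneg _) (stepLen_pos hS hr _).le
  have huk := hu k
  have hlt : ∑ l ∈ Finset.Ico l j, (digit c k l : ℝ) * stepLen S r (l + 1) + u k <
      stepLen S r l / S := by linarith [huk.2]
  rw [hz, digitOffset_apply c j hk, ← Finset.sum_range_add_sum_Ico _ hlj, hN, add_assoc,
    fract_div_of_eq hl rfl (add_nonneg h0 huk.1)
      (hlt.trans_le (div_le_self hl.le (by exact_mod_cast hS))), div_lt_iff₀ hl]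
  rwa [one_div, inv_mul_eq_div]

lemma signAt_eq_one (hS : 2 ≤ S) (hr : 0 < r) (c : Fin M → Fin d → Fin S) (i j : ℕ) {u : Euc d}
    (hu : u ∈ halfOpenCube d (stepLen S r j / S)) :
    signAt i₀ S r j (digitOffset i₀ r c j +
      (i * stepLen S r j) • EuclideanSpace.single i₀ (1 : ℝ) + u) = 1 := by
  have hl := stepLen_pos (show 0 < S by omega) hr j
  have h1 : (1 : ℝ) ≤ S := by exact_mod_cast (show 1 ≤ S by omega)
  have huk := hu i₀
  refine if_pos ?_
  have hz : (digitOffset i₀ r c j + (i * stepLen S r j) • EuclideanSpace.single i₀ (1 : ℝ) + u) i₀ =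
      i * stepLen S r j + u i₀ := by
    simp [digitOffset_apply_self]
  rw [hz, fract_div_of_eq hl rfl huk.1 (huk.2.trans_le (div_le_self hl.le h1)), div_lt_iff₀ hl,
    one_div, inv_mul_eq_div]
  exact huk.2

lemma signAt_eq_neg_one (hS : 2 ≤ S) (hr : 0 < r) (c : Fin M → Fin d → Fin S) (i j : ℕ)
    {u : Euc d} (hu : u ∈ halfOpenCube d (stepLen S r j / S)) :
    signAt i₀ S r j (digitOffset i₀ r c j + (i * stepLen S r j + stepLen S r j / S) •
      EuclideanSpace.single i₀ (1 : ℝ) + u) = -1 := by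
  have hl := stepLen_pos (show 0 < S by omega) hr j
  have h1 : (2 : ℝ) ≤ S := by exact_mod_cast hS
  have huk := hu i₀
  refine if_neg ?_
  have hz : (digitOffset i₀ r c j + (i * stepLen S r j + stepLen S r j / S) •
      EuclideanSpace.single i₀ (1 : ℝ) + u) i₀ =
      i * stepLen S r j + (stepLen S r j / S + u i₀) := by
    simp [digitOffset_apply_self, add_assoc]
  have h2 : stepLen S r j / S ≤ stepLen S r j / 2 := by gcongr
  have h3 : 0 < stepLen S r j / S := by positivity
  rw [hz, fract_div_of_eq hl rfl (by linarith [huk.1]) (by linarith [huk.2]), div_lt_iff₀ hl,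
    one_div, inv_mul_eq_div]
  linarith [huk.1]

lemma mem_slab_of_mem_thinSet (hS : 0 < S) (hr : 0 < r) (c : Fin M → Fin d → Fin S) {j : ℕ}
    {u : Euc d} (hu : u ∈ halfOpenCube d (stepLen S r j / S)) (t : ℝ) {k : Fin d} (hk : k ≠ i₀)
    (h : digitOffset i₀ r c j + t • EuclideanSpace.single i₀ (1 : ℝ) + u ∈
      thinSet i₀ S r (j + 1)) :
    ∃ m < S, u k ∈ Ico (m * stepLen S r (j + 1))
      (m * stepLen S r (j + 1) + stepLen S r (j + 1) / S) := by
  have hSR : (0 : ℝ) < S := by positivity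
  have hl := stepLen_pos hS hr (j + 1)
  have hz : (digitOffset i₀ r c j + t • EuclideanSpace.single i₀ (1 : ℝ) + u) k =
      digitOffset i₀ r c j k + u k := by
    simp [hk]
  have h1 := h k hk
  obtain ⟨N, hN⟩ := exists_sum_digits_eq (r := r) hS (digit c k) j
  have huk := hu k
  rw [hz, digitOffset_apply c j hk, hN, ← stepLen_succ_mul hS j,
    show (N : ℝ) * (stepLen S r (j + 1) * (S : ℝ) ^ 2) = ((N * S ^ 2 : ℕ) : ℝ) *
      stepLen S r (j + 1) by push_cast; ring, add_div, mul_div_assoc, div_self hl.ne', mul_one,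
    Int.fract_natCast_add, Int.fract,
    natCast_floor_eq_intCast_floor (div_nonneg huk.1 hl.le) |>.symm,
    sub_lt_iff_lt_add, div_lt_iff₀ hl] at h1
  refine ⟨⌊u k / stepLen S r (j + 1)⌋₊, ?_, ?_, ?_⟩
  · rw [Nat.floor_lt (div_nonneg huk.1 hl.le), div_lt_iff₀ hl]
    refine huk.2.trans_eq ?_
    rw [← stepLen_succ_mul hS j]
    field_simp
  · rw [← le_div_iff₀ hl]
    exact Nat.floor_le (div_nonneg huk.1 hl.le)
  · refine h1.trans_eq ?_
    ring

end Oscillation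

section Measure

variable {d : ℕ}

lemma setOf_forall_mem_Ico_eq_preimage (a b : Fin d → ℝ) :
    {x : Euc d | ∀ k, x k ∈ Ico (a k) (b k)} =
      (@WithLp.ofLp 2 (Fin d → ℝ)) ⁻¹' (univ.pi fun k => Ico (a k) (b k)) := by
  ext x; simp [Set.mem_pi]

lemma measurableSet_box (a b : Fin d → ℝ) :
    MeasurableSet {x : Euc d | ∀ k, x k ∈ Ico (a k) (b k)} := by
  rw [setOf_forall_mem_Ico_eq_preimage]
  exact (PiLp.volume_preserving_ofLp (Fin d)).measurable
    (MeasurableSet.univ_pi fun _ => measurableSet_Ico)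

lemma volume_box (a b : Fin d → ℝ) :
    volume {x : Euc d | ∀ k, x k ∈ Ico (a k) (b k)} = ∏ k, ENNReal.ofReal (b k - a k) := by
  rw [setOf_forall_mem_Ico_eq_preimage, (PiLp.volume_preserving_ofLp (Fin d)).measure_preimage
    (MeasurableSet.univ_pi fun _ => measurableSet_Ico).nullMeasurableSet, Real.volume_pi_Ico]

lemma measurableSet_halfOpenCube (s : ℝ) : MeasurableSet (halfOpenCube d s) :=
  measurableSet_box _ _

lemma volume_halfOpenCube {s : ℝ} (hs : 0 ≤ s) :
    volume (halfOpenCube d s) = ENNReal.ofReal (s ^ d) := by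
  rw [halfOpenCube, volume_box]
  simp [ENNReal.ofReal_pow hs]

/-- The points of a cube which lie in one of `S` thin parallel slabs. -/
def slabCube (d : ℕ) (s h : ℝ) (S : ℕ) (k : Fin d) : Set (Euc d) :=
  {u | u ∈ halfOpenCube d s ∧ ∃ m < S, u k ∈ Ico (m * h) (m * h + h / S)}

lemma slabCube_eq_iUnion (s h : ℝ) (S : ℕ) (k : Fin d) :
    slabCube d s h S k = halfOpenCube d s ∩
      ⋃ m : Fin S, (fun u : Euc d => u k) ⁻¹' Ico (m * h) (m * h + h / S) := by
  ext u
  simp only [slabCube, mem_ofPred_eq, mem_inter_iff, mem_iUnion, mem_preimage]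
  refine and_congr_right fun _ => ⟨fun ⟨m, hm, h⟩ => ⟨⟨m, hm⟩, h⟩, fun ⟨m, h⟩ => ⟨m, m.2, h⟩⟩

lemma measurableSet_slabCube (s h : ℝ) (S : ℕ) (k : Fin d) :
    MeasurableSet (slabCube d s h S k) := by
  rw [slabCube_eq_iUnion]
  exact (measurableSet_halfOpenCube s).inter
    (MeasurableSet.iUnion fun m => measurable_coord k measurableSet_Ico)

lemma volume_slabCube_le {s h : ℝ} (hs : 0 ≤ s) {S : ℕ} (hS : 0 < S) (hsh : s = S * h)
    (k : Fin d) : volume (slabCube d s h S k) ≤ ENNReal.ofReal (s ^ d / S) := by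
  classical
  have hS' : (0 : ℝ) < S := by positivity
  have hh : h = s / S := by rw [hsh]; field_simp
  have hh0 : 0 ≤ h := by rw [hh]; positivity
  rw [slabCube_eq_iUnion, inter_iUnion]
  refine (measure_iUnion_le _).trans ?_
  have hone : ∀ m : Fin S, volume (halfOpenCube d s ∩
      (fun u : Euc d => u k) ⁻¹' Ico (m * h) (m * h + h / S)) ≤
      ENNReal.ofReal (s ^ d / S / S) := by
    intro m
    calc _ ≤ volume {u : Euc d | ∀ l, u l ∈ Ico (if l = k then (m : ℝ) * h else 0)
          (if l = k then m * h + h / S else s)} := by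
          refine measure_mono fun u hu l => ?_
          by_cases hl : l = k
          · subst hl; simpa using hu.2
          · simpa [hl] using hu.1 l
      _ = ENNReal.ofReal (∏ l : Fin d, if l = k then h / S else s) := by
          rw [volume_box, ENNReal.ofReal_prod_of_nonneg]
          · refine Finset.prod_congr rfl fun l _ => ?_
            split_ifs <;> simp
          · intro l _
            split_ifs <;> positivity
      _ ≤ _ := by
          refine ENNReal.ofReal_le_ofReal (le_of_eq ?_)
          have hd : d - 1 + 1 = d := Nat.sub_add_cancel (Fin.pos k)
          rw [Finset.prod_ite, Finset.prod_const, Finset.prod_const, Finset.filter_eq',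
            if_pos (Finset.mem_univ k), Finset.card_singleton, pow_one, Finset.filter_ne',
            Finset.card_erase_of_mem (Finset.mem_univ k), Finset.card_univ, Fintype.card_fin,
            hh, ← hd, pow_succ, Nat.add_sub_cancel]
          ring
  refine (ENNReal.summable.tsum_le_tsum hone ENNReal.summable).trans (le_of_eq ?_)
  rw [tsum_fintype, Finset.sum_const, Finset.card_univ, Fintype.card_fin, nsmul_eq_mul,
    ← ENNReal.ofReal_natCast, ← ENNReal.ofReal_mul hS'.le]
  congr 1
  field_simp

/-- Continuity of translations in `L¹`. -/
lemma exists_lintegral_translation_sub_le {φ : Euc d → ℝ} (hφ : Integrable φ) {e : ENNReal}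
    (he : 0 < e) : ∃ δ > 0, ∀ t : Euc d, ‖t‖ < δ → ∫⁻ x, ‖φ (x + t) - φ x‖ₑ ≤ e := by
  have hmp : ∀ t : Euc d, MeasurePreserving (fun x : Euc d => x + t) volume volume :=
    fun t => measurePreserving_add_right volume t
  set τ : C(Euc d, C(Euc d, Euc d)) :=
    ContinuousMap.curry ⟨fun q : Euc d × Euc d => q.2 + q.1, by fun_prop⟩ with hτ
  have hτa : ∀ t x, τ t x = x + t := fun t x => rfl
  set g : Lp ℝ 1 (volume : Measure (Euc d)) := (memLp_one_iff_integrable.2 hφ).toLp φ with hg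
  have hmp' : ∀ t, MeasurePreserving (τ t) volume volume := hmp
  have hcont : Continuous fun t => Lp.compMeasurePreserving (τ t) (hmp' t) g :=
    Continuous.compMeasurePreservingLp continuous_const τ.continuous hmp' ENNReal.one_ne_top
  obtain ⟨δ, hδ, h⟩ := Metric.eventually_nhds_iff.1
    ((hcont.tendsto 0).eventually (Metric.eball_mem_nhds _ he))
  refine ⟨δ, hδ, fun t ht => ?_⟩
  have hφg : φ =ᵐ[volume] g := (MemLp.coeFn_toLp _).symm
  have hcomp : ∀ t, (fun x => φ (x + t)) =ᵐ[volume]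
      Lp.compMeasurePreserving (τ t) (hmp' t) g := by
    intro t
    refine EventuallyEq.trans ?_ (Lp.coeFn_compMeasurePreserving g (hmp' t)).symm
    exact (hmp t).quasiMeasurePreserving.ae_eq_comp hφg
  have hzero : φ =ᵐ[volume] Lp.compMeasurePreserving (τ 0) (hmp' 0) g := by
    have := hcomp 0
    simpa using this
  have hlt := h (y := t) (by simpa using ht)
  rw [Lp.edist_def, eLpNorm_one_eq_lintegral_enorm] at hlt
  refine le_trans (le_of_eq (lintegral_congr_ae ?_)) hlt.le
  filter_upwards [hcomp t, hzero] with x h1 h2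
  rw [Pi.sub_apply, ← h1, ← h2]

/-- The mean over a cube of side `s` with corner at `p` of the oscillation of `φ` under a shift. -/
def shiftMean (φ : Euc d → ℝ) (e₁ : Euc d) (s : ℝ) (p : Euc d) : ENNReal :=
  ENNReal.ofReal ((s ^ d)⁻¹) * ∫⁻ x in halfOpenCube d s, ‖φ (p + x + s • e₁) - φ (p + x)‖ₑ

lemma measurable_shiftMean {φ : Euc d → ℝ} (hφ : Measurable φ) (e₁ : Euc d) (s : ℝ) :
    Measurable (shiftMean φ e₁ s) := by
  refine Measurable.const_mul (Measurable.lintegral_prod_right'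
    (f := fun q : Euc d × Euc d => ‖φ (q.1 + q.2 + s • e₁) - φ (q.1 + q.2)‖ₑ) ?_) _
  fun_prop

lemma lintegral_shiftMean_le {φ : Euc d → ℝ} (hφ : Measurable φ) {e₁ : Euc d} {s : ℝ}
    (hs : 0 < s) {e : ENNReal} (he : ∫⁻ x, ‖φ (x + s • e₁) - φ x‖ₑ ≤ e) (o : Euc d) :
    ∫⁻ p, shiftMean φ e₁ s (p + o) ≤ e := by
  unfold shiftMean
  rw [lintegral_const_mul', lintegral_lintegral_swap]
  · have h1 : ∀ x : Euc d, ∫⁻ p, ‖φ (p + o + x + s • e₁) - φ (p + o + x)‖ₑ ≤ e := by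
      intro x
      refine le_trans (le_of_eq ?_) he
      rw [← lintegral_add_right_eq_self (fun y => ‖φ (y + s • e₁) - φ y‖ₑ) (o + x)]
      simp only [add_assoc]
    calc _ ≤ ENNReal.ofReal ((s ^ d)⁻¹) * ∫⁻ x in halfOpenCube d s, e := by
          gcongr with x
          exact h1 x
      _ = e := by
          rw [lintegral_const, Measure.restrict_apply_univ, volume_halfOpenCube hs.le, mul_comm e,
            ← mul_assoc, ← ENNReal.ofReal_mul (by positivity), inv_mul_cancel₀ (by positivity),
            ENNReal.ofReal_one, one_mul]
  · refine Measurable.aemeasurable ?_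
    fun_prop
  · exact ENNReal.ofReal_ne_top

/-- There is a translation for which the weighted sum of finitely many shift means is small. -/
lemma exists_sum_shiftMean_le {φ : Euc d → ℝ} (hφ : Measurable φ) {e₁ : Euc d} {ι : Type*}
    [Fintype ι] (c s : ι → ℝ) (o : ι → Euc d) (hc : ∀ n, 0 ≤ c n) (hs : ∀ n, 0 < s n) {e : ℝ}
    (he0 : 0 ≤ e) (he : ∀ n, ∫⁻ x, ‖φ (x + s n • e₁) - φ x‖ₑ ≤ ENNReal.ofReal e) :
    ∃ p : Euc d, (∀ k, p k ∈ Ico (1 / 4 : ℝ) (1 / 2)) ∧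
      ∑ n, ENNReal.ofReal (c n) * shiftMean φ e₁ (s n) (p + o n) ≤
        ENNReal.ofReal ((∑ n, c n) * (4 ^ d * e)) := by
  have hvol : volume {p : Euc d | ∀ k, p k ∈ Ico (1 / 4 : ℝ) (1 / 2)} =
      ENNReal.ofReal ((1 / 4) ^ d) := by
    rw [volume_box]
    norm_num [ENNReal.ofReal_pow]
  have hmeas : ∀ n, Measurable fun p => shiftMean φ e₁ (s n) (p + o n) := fun n =>
    (measurable_shiftMean hφ e₁ (s n)).comp (measurable_add_const _)
  obtain ⟨p, hp, hle⟩ := exists_le_setLAverage (μ := volume)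
    (s := {p : Euc d | ∀ k, p k ∈ Ico (1 / 4 : ℝ) (1 / 2)})
    (f := fun p => ∑ n, ENNReal.ofReal (c n) * shiftMean φ e₁ (s n) (p + o n))
    (by rw [hvol]; exact (ENNReal.ofReal_pos.2 (by positivity)).ne')
    (by rw [hvol]; exact ENNReal.ofReal_ne_top)
    (Finset.measurable_sum _ fun n _ => (hmeas n).const_mul _).aemeasurable
  refine ⟨p, hp, hle.trans ?_⟩
  rw [setLAverage_eq, hvol, lintegral_finsetSum _ fun n _ => (hmeas n).const_mul _]
  refine ENNReal.div_le_of_le_mul ?_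
  rw [← ENNReal.ofReal_mul (mul_nonneg (Finset.sum_nonneg fun n _ => hc n) (by positivity))]
  calc _ ≤ ∑ n, ENNReal.ofReal (c n) * ENNReal.ofReal e := by
        refine Finset.sum_le_sum fun n _ => ?_
        rw [lintegral_const_mul _ (hmeas n)]
        gcongr
        exact (setLIntegral_le_lintegral _ _).trans (lintegral_shiftMean_le hφ (hs n) (he n) (o n))
    _ = ENNReal.ofReal ((∑ n, c n) * e) := by
        rw [← Finset.sum_mul, ← ENNReal.ofReal_sum_of_nonneg fun n _ => hc n,
          ← ENNReal.ofReal_mul (Finset.sum_nonneg fun n _ => hc n)]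
    _ = _ := by
        congr 1
        have : (4 : ℝ) ^ d * (1 / 4) ^ d = 1 := by rw [← mul_pow]; norm_num
        linear_combination (-(∑ n, c n) * e) * this

end Measure

section NearConstancy

variable {d : ℕ}

lemma norm_le_of_abs_apply_le {x : Euc d} {t : ℝ} (ht : 0 ≤ t) (h : ∀ k, |x k| ≤ t) :
    ‖x‖ ≤ d * t := by
  rw [EuclideanSpace.norm_eq]
  refine Real.sqrt_le_iff.2 ⟨by positivity, ?_⟩
  calc ∑ k, ‖x k‖ ^ 2 ≤ ∑ _k : Fin d, t ^ 2 := by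
        gcongr with k
        exact h k
    _ = d * t ^ 2 := by simp
    _ ≤ (d : ℝ) ^ 2 * t ^ 2 := by
        gcongr
        exact_mod_cast Nat.le_self_pow two_ne_zero d
    _ = _ := by ring

lemma norm_sub_le_of_incrementVariance_le {E : Type*} [NormedAddCommGroup E]
    [InnerProductSpace ℝ E] (F : ℝ → E) {S : ℕ} (hS : 0 < S) {r η : ℝ} (hη : 0 ≤ η) {i l : ℕ}
    (hl : l + S ≤ S ^ 2) (h : incrementVariance F (S ^ 2) r i ≤ η ^ 2) :
    ‖F ((i * S ^ 2 + l + S : ℕ) * (r / (S ^ 2 : ℕ))) - F ((i * S ^ 2 + l : ℕ) * (r / (S ^ 2 : ℕ))) -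
      (S : ℝ)⁻¹ • increment F r i‖ ≤ S * η := by
  have hS' : (S : ℝ) ≠ 0 := by positivity
  have hterm : ∀ m ∈ Finset.range S, ‖increment F (r / (S ^ 2 : ℕ)) (i * S ^ 2 + l + m) -
      (((S ^ 2 : ℕ) : ℝ))⁻¹ • increment F r i‖ ≤ η := by
    intro m hm
    rw [Finset.mem_range] at hm
    refine abs_le_of_sq_le_sq' ?_ hη |>.2
    refine le_trans ?_ h
    have := Finset.single_le_sum (s := Finset.range (S ^ 2)) (f := fun l =>
      ‖increment F (r / (S ^ 2 : ℕ)) (i * S ^ 2 + l) -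
        (((S ^ 2 : ℕ) : ℝ))⁻¹ • increment F r i‖ ^ 2)
      (fun _ _ => sq_nonneg _) (Finset.mem_range.2 (show l + m < S ^ 2 by omega))
    rw [add_assoc]
    exact this
  have := norm_sum_le_of_le _ hterm
  rw [Finset.sum_sub_distrib, sum_increment] at this
  simp only [Finset.sum_const, Finset.card_range, nsmul_eq_mul] at this
  refine le_trans (le_of_eq ?_) this
  congr 2
  rw [← Nat.cast_smul_eq_nsmul ℝ, smul_smul]
  congr 1
  push_cast
  field_simp

variable {i₀ : Fin d} {S M : ℕ} {r : ℝ}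

lemma digitOffset_apply_mem (hS : 0 < S) (hr : 0 < r) (c : Fin M → Fin d → Fin S) (j : ℕ)
    (k : Fin d) : digitOffset i₀ r c j k ∈ Icc 0 (r / S) := by
  have hSR : (0 : ℝ) < S := by positivity
  by_cases hk : k = i₀
  · subst hk
    rw [digitOffset_apply_self]
    exact ⟨le_rfl, by positivity⟩
  · rw [digitOffset_apply c j hk]
    have h1 := sum_digits_add_le hS hr (digit_lt hS c k) (Nat.zero_le j)
    have h2 := stepLen_pos hS hr j
    rw [stepLen_zero, ← Finset.range_eq_Ico] at h1
    refine ⟨Finset.sum_nonneg fun l _ => ?_, ?_⟩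
    · have := stepLen_pos hS hr (l + 1)
      positivity
    · have : 0 ≤ stepLen S r j / S := by positivity
      linarith

/-- The difference of transversal offsets of two digit sequences agreeing below `j`. -/
lemma digitOffset_sub_apply_mem (hS : 0 < S) (hr : 0 < r) {a c : Fin M → Fin d → Fin S} {j n : ℕ}
    (hjn : j ≤ n) (hac : ∀ k : Fin M, (k : ℕ) < j → c k = a k) (k : Fin d) :
    digitOffset i₀ r c n k - digitOffset i₀ r a j k ∈ Icc 0 (stepLen S r j / S) := by
  have hSR : (0 : ℝ) < S := by positivity
  have hj := stepLen_pos hS hr j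
  by_cases hk : k = i₀
  · subst hk
    rw [digitOffset_apply_self, digitOffset_apply_self, sub_zero]
    exact ⟨le_rfl, by positivity⟩
  · rw [digitOffset_apply c n hk, digitOffset_apply a j hk]
    have h0 : ∑ l ∈ Finset.range j, (digit a k l : ℝ) * stepLen S r (l + 1) =
        ∑ l ∈ Finset.range j, (digit c k l : ℝ) * stepLen S r (l + 1) := by
      refine Finset.sum_congr rfl fun l hl => ?_
      have hlj := Finset.mem_range.1 hl
      congr 2
      unfold digit
      split_ifs with h
      · rw [hac ⟨l, h⟩ hlj]
      · rfl
    rw [h0, ← Finset.sum_range_add_sum_Ico _ hjn, add_sub_cancel_left]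
    have h1 := sum_digits_add_le hS hr (digit_lt hS c k) hjn
    have h2 := stepLen_pos hS hr n
    refine ⟨Finset.sum_nonneg fun l _ => ?_, ?_⟩
    · have := stepLen_pos hS hr (l + 1)
      positivity
    · have : 0 ≤ stepLen S r n / S := by positivity
      linarith

/-- The deviation of a point of the cell from the corresponding grid point. -/
lemma abs_cell_sub_grid_le (hS : 0 < S) (hr : 0 < r) {a c : Fin M → Fin d → Fin S} {j : Fin M}
    (hac : ∀ k : Fin M, (k : ℕ) < j → c k = a k) {u : Euc d} (hu : ∀ k, 0 ≤ u k)
    (hc : ∀ k, (c j k : ℕ) = ⌊u k / stepLen S r (j + 1)⌋₊) (t : ℝ) (k : Fin d) :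
    |(digitOffset i₀ r a j + t • EuclideanSpace.single i₀ (1 : ℝ) + u -
      (digitOffset i₀ r c M + (t + (c j i₀ : ℕ) * stepLen S r (j + 1)) •
        EuclideanSpace.single i₀ (1 : ℝ))) k| ≤ stepLen S r (j + 1) := by
  have hSR : (0 : ℝ) < S := by positivity
  have hS1 : (1 : ℝ) ≤ S := by exact_mod_cast hS
  have hj := stepLen_pos hS hr (j + 1)
  have h1 : (c j k : ℕ) * stepLen S r (j + 1) ≤ u k := by
    rw [hc, ← le_div_iff₀ hj]
    exact Nat.floor_le (div_nonneg (hu k) hj.le)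
  have h2 : u k < ((c j k : ℕ) + 1) * stepLen S r (j + 1) := by
    rw [hc, ← div_lt_iff₀ hj]
    exact Nat.lt_floor_add_one _
  by_cases hk : k = i₀
  · subst hk
    have : (digitOffset k r a j + t • EuclideanSpace.single k (1 : ℝ) + u -
      (digitOffset k r c M + (t + (c j k : ℕ) * stepLen S r (j + 1)) •
        EuclideanSpace.single k (1 : ℝ))) k = u k - (c j k : ℕ) * stepLen S r (j + 1) := by
      simp [digitOffset_apply_self]
    rw [this, abs_le]
    constructor <;> nlinarith
  · have h3 := digitOffset_sub_apply_mem (i₀ := i₀) hS hr (a := c) (c := c) (j := j + 1) (n := M)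
      j.2 (fun _ _ => rfl) k
    have h4 : digitOffset i₀ r c (j + 1) k =
        digitOffset i₀ r a j k + (c j k : ℕ) * stepLen S r (j + 1) := by
      rw [digitOffset_apply c _ hk, Finset.sum_range_succ, digitOffset_apply a _ hk]
      congr 1
      · refine Finset.sum_congr rfl fun l hl => ?_
        have hlj := Finset.mem_range.1 hl
        congr 2
        unfold digit
        split_ifs with h
        · rw [hac ⟨l, h⟩ hlj]
        · rfl
      · congr 2
        exact dif_pos j.2
    have h5 : stepLen S r (j + 1) / S ≤ stepLen S r (j + 1) := div_le_self hj.le hS1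
    have : (digitOffset i₀ r a j + t • EuclideanSpace.single i₀ (1 : ℝ) + u -
      (digitOffset i₀ r c M + (t + (c j i₀ : ℕ) * stepLen S r (j + 1)) •
        EuclideanSpace.single i₀ (1 : ℝ))) k =
        digitOffset i₀ r a j k + u k - digitOffset i₀ r c M k := by
      simp [hk]
    rw [this, abs_le]
    constructor <;> nlinarith [h3.1, h3.2]

lemma add_offset_apply_mem (hS : 0 < S) (hr : 0 < r) (hr' : r ≤ 1 / 16) {p : Euc d}
    (hp : ∀ k, p k ∈ Ico (1 / 4 : ℝ) (1 / 2)) (c : Fin M → Fin d → Fin S) (n : ℕ) {t : ℝ}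
    (ht : t ∈ Icc 0 (2 * r)) {u : Euc d} (hu : ∀ k, u k ∈ Icc 0 r) (k : Fin d) :
    (p + (digitOffset i₀ r c n + t • EuclideanSpace.single i₀ (1 : ℝ) + u)) k ∈
      Icc (1 / 4 : ℝ) (3 / 4) := by
  have h1 := digitOffset_apply_mem (i₀ := i₀) hS hr c n k
  have h2 : r / S ≤ r := div_le_self hr.le (by exact_mod_cast hS)
  have h3 := hp k
  have h4 := hu k
  obtain ⟨t', ht', h⟩ : ∃ t' ∈ Icc 0 (2 * r),
      (p + (digitOffset i₀ r c n + t • EuclideanSpace.single i₀ (1 : ℝ) + u)) k =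
      p k + (digitOffset i₀ r c n k + t' + u k) := by
    by_cases hk : k = i₀
    · exact ⟨t, ht, by simp [hk]⟩
    · exact ⟨0, ⟨le_rfl, by linarith⟩, by simp [hk]⟩
  rw [h]
  constructor <;> linarith [h1.1, h1.2, h3.1, h3.2, h4.1, h4.2, ht'.1, ht'.2]

lemma mem_unitCube_of_mem_Icc {x : Euc d} (h : ∀ k, x k ∈ Icc (1 / 4 : ℝ) (3 / 4)) :
    x ∈ unitCube d := fun k =>
  ⟨by linarith [(h k).1], by linarith [(h k).2]⟩

lemma stepLen_div_eq (hS : 0 < S) (j : ℕ) : stepLen S r j / S = S * stepLen S r (j + 1) := by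
  have : (S : ℝ) ≠ 0 := by positivity
  rw [← stepLen_succ_mul hS j]
  field_simp

lemma succ_mul_stepLen_le (hS : 0 < S) (hr : 0 < r) {i j : ℕ} (hi : i < (S ^ 2) ^ j) :
    (i + 1) * stepLen S r j ≤ r := by
  have h1 : (i : ℝ) + 1 ≤ ((S ^ 2 : ℕ) : ℝ) ^ j := by exact_mod_cast hi
  unfold stepLen
  rw [mul_div_left_comm]
  refine mul_le_of_le_one_right hr.le ?_
  rw [div_le_one (by positivity)]
  exact h1

/-- On a cell all of whose grid lines carry almost constant increments, the difference of `f` under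
the shift to the neighbouring cube is almost constant. -/
lemma exists_forall_cell_norm_le {f : Euc d → Euc d} {L : ℝ} (hd : 1 ≤ d) (hS : 2 ≤ S)
    (hr : 0 < r) (hr' : r ≤ 1 / 16) {p : Euc d} (hp : ∀ k, p k ∈ Ico (1 / 4 : ℝ) (1 / 2))
    (hL0 : 0 ≤ L)
    (hL : ∀ x ∈ unitCube d, ∀ y ∈ unitCube d, ∀ t, stepLen S r M ≤ t → t ≤ d * r →
      dist x y ≤ t → dist (f x) (f y) ≤ L * t)
    (a : Fin M → Fin d → Fin S) (j : Fin M) {i : ℕ} (hi : i < (S ^ 2) ^ (j : ℕ))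
    (hc : ∀ v : Fin d → Fin S, ∃ c : Fin M → Fin d → Fin S,
      (∀ k : Fin M, (k : ℕ) < j → c k = a k) ∧ c j = v ∧
      incrementVariance (fun t => f (p + (digitOffset i₀ r c M +
        t • EuclideanSpace.single i₀ (1 : ℝ)))) (S ^ 2) (stepLen S r j) i ≤
        (L / S * stepLen S r (j + 1)) ^ 2) :
    ∃ w : Euc d, ∀ u ∈ halfOpenCube d (stepLen S r j / S),
      ‖f (p + (digitOffset i₀ r a j + (i * stepLen S r j + stepLen S r j / S) •
          EuclideanSpace.single i₀ (1 : ℝ) + u)) -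
        f (p + (digitOffset i₀ r a j + (i * stepLen S r j) •
          EuclideanSpace.single i₀ (1 : ℝ) + u)) - w‖ ≤ 5 * d * L * stepLen S r (j + 1) := by
  have hS0 : 0 < S := by omega
  have hSR : (0 : ℝ) < S := by positivity
  have hS1 : (2 : ℝ) ≤ S := by exact_mod_cast hS
  have hd1 : (1 : ℝ) ≤ d := by exact_mod_cast hd
  have hq := stepLen_pos hS0 hr (j + 1)
  have hsj := stepLen_pos hS0 hr j
  have hsr : stepLen S r j ≤ r := by
    have := stepLen_anti hS0 hr (Nat.zero_le j)
    rwa [stepLen_zero] at this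
  have hqM : stepLen S r M ≤ stepLen S r (j + 1) := stepLen_anti hS0 hr j.2
  have hdiv := stepLen_div_eq (r := r) hS0 j
  have hmul := stepLen_succ_mul (r := r) hS0 j
  have hir := succ_mul_stepLen_le hS0 hr hi
  have hi0 : (0 : ℝ) ≤ i := by positivity
  have hsS : stepLen S r j / S ≤ stepLen S r j := div_le_self hsj.le (by linarith)
  have hqs : stepLen S r (j + 1) ≤ stepLen S r j / S := by rw [hdiv]; nlinarith
  set e : Euc d := EuclideanSpace.single i₀ (1 : ℝ) with he
  refine ⟨(S : ℝ)⁻¹ • (f (p + (digitOffset i₀ r a j + ((i + 1 : ℕ) * stepLen S r j) • e)) -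
    f (p + (digitOffset i₀ r a j + (i * stepLen S r j) • e))), fun u hu => ?_⟩
  have hu' : ∀ k, u k ∈ Icc 0 r := fun k =>
    ⟨(hu k).1, by linarith [(hu k).2]⟩
  have hfl : ∀ k, ⌊u k / stepLen S r (j + 1)⌋₊ < S := fun k => by
    rw [Nat.floor_lt (div_nonneg (hu k).1 hq.le), div_lt_iff₀ hq, ← hdiv]
    exact (hu k).2
  obtain ⟨c, hca, hcj, hvar⟩ := hc fun k => ⟨_, hfl k⟩
  have hcv : ∀ k, (c j k : ℕ) = ⌊u k / stepLen S r (j + 1)⌋₊ := fun k => by rw [hcj]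
  have hl : (c j i₀ : ℕ) < S := (c j i₀).2
  have hlR : ((c j i₀ : ℕ) : ℝ) * stepLen S r (j + 1) ≤ stepLen S r j / S := by
    rw [hdiv]
    have : ((c j i₀ : ℕ) : ℝ) ≤ S := by exact_mod_cast hl.le
    gcongr
  have hlR0 : 0 ≤ ((c j i₀ : ℕ) : ℝ) * stepLen S r (j + 1) := by positivity
  have h0u : ∀ k, (0 : Euc d) k ∈ Icc 0 r := fun k => ⟨le_rfl, hr.le⟩
  have hmem : ∀ (c : Fin M → Fin d → Fin S) (n : ℕ) (t : ℝ), t ∈ Icc 0 (2 * r) →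
      p + (digitOffset i₀ r c n + t • e) ∈ unitCube d := fun c n t ht => by
    have := add_offset_apply_mem (i₀ := i₀) hS0 hr hr' hp c n ht h0u
    rw [add_zero] at this
    exact mem_unitCube_of_mem_Icc this
  have hnear : ∀ t ∈ Icc 0 r,
      dist (f (p + (digitOffset i₀ r a j + t • e + u)))
        (f (p + (digitOffset i₀ r c M + (t + (c j i₀ : ℕ) * stepLen S r (j + 1)) • e))) ≤
      L * (d * stepLen S r (j + 1)) := by
    intro t ht
    refine hL _ (mem_unitCube_of_mem_Icc (add_offset_apply_mem hS0 hr hr' hp a j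
      ⟨ht.1, by linarith [ht.2]⟩ hu')) _ (hmem _ _ _ ⟨by linarith [ht.1], by linarith [ht.2]⟩) _
      (by nlinarith) (by gcongr; linarith) ?_
    rw [dist_add_left, dist_eq_norm]
    exact norm_le_of_abs_apply_le hq.le
      (abs_cell_sub_grid_le hS0 hr hca (fun k => (hu k).1) hcv t)
  have href : ∀ t ∈ Icc 0 r,
      dist (f (p + (digitOffset i₀ r c M + t • e))) (f (p + (digitOffset i₀ r a j + t • e))) ≤
      L * (d * (stepLen S r j / S)) := by
    intro t ht
    have ht' : t ∈ Icc 0 (2 * r) := ⟨ht.1, by linarith [ht.2]⟩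
    refine hL _ (hmem _ _ _ ht') _ (hmem _ _ _ ht') _ (by nlinarith) (by gcongr; linarith) ?_
    rw [dist_add_left, dist_add_right, dist_eq_norm]
    refine norm_le_of_abs_apply_le (by positivity) fun k => ?_
    have := digitOffset_sub_apply_mem (i₀ := i₀) hS0 hr (n := M) j.2.le hca k
    rw [PiLp.sub_apply, abs_of_nonneg this.1]
    exact this.2
  have hvar' := norm_sub_le_of_incrementVariance_le _ hS0 (by positivity) (l := (c j i₀ : ℕ))
    (by nlinarith) hvar
  have ht0 : ((i * S ^ 2 + (c j i₀ : ℕ) : ℕ) : ℝ) * (stepLen S r j / (S ^ 2 : ℕ)) =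
      i * stepLen S r j + (c j i₀ : ℕ) * stepLen S r (j + 1) := by
    rw [← hmul]; push_cast; field_simp
  have ht1 : ((i * S ^ 2 + (c j i₀ : ℕ) + S : ℕ) : ℝ) * (stepLen S r j / (S ^ 2 : ℕ)) =
      i * stepLen S r j + stepLen S r j / S + (c j i₀ : ℕ) * stepLen S r (j + 1) := by
    rw [← hmul]; push_cast; field_simp
    ring
  rw [ht0, ht1] at hvar'
  have e1 := hnear (i * stepLen S r j + stepLen S r j / S) ⟨by positivity, by linarith⟩
  have e0 := hnear (i * stepLen S r j) ⟨by positivity, by linarith⟩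
  have g1 := href ((i + 1 : ℕ) * stepLen S r j) ⟨by positivity, by push_cast; linarith⟩
  have g0 := href (i * stepLen S r j) ⟨by positivity, by linarith⟩
  simp only [increment] at hvar'
  rw [dist_eq_norm] at e1 e0 g1 g0
  generalize f (p + (digitOffset i₀ r a j + (i * stepLen S r j + stepLen S r j / S) • e + u)) = f1
    at *
  generalize f (p + (digitOffset i₀ r a j + (i * stepLen S r j) • e + u)) = f0 at *
  generalize f (p + (digitOffset i₀ r a j + ((i + 1 : ℕ) * stepLen S r j) • e)) = b1 at *
  generalize f (p + (digitOffset i₀ r a j + (i * stepLen S r j) • e)) = b0 at *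
  generalize f (p + (digitOffset i₀ r c M + ((i + 1 : ℕ) * stepLen S r j) • e)) = a1 at *
  generalize f (p + (digitOffset i₀ r c M + (i * stepLen S r j) • e)) = a0 at *
  generalize f (p + (digitOffset i₀ r c M + (i * stepLen S r j +
    (c j i₀ : ℕ) * stepLen S r (j + 1)) • e)) = x0 at *
  generalize f (p + (digitOffset i₀ r c M + (i * stepLen S r j + stepLen S r j / S +
    (c j i₀ : ℕ) * stepLen S r (j + 1)) • e)) = x1 at *
  have hsplit : f1 - f0 - (S : ℝ)⁻¹ • (b1 - b0) = (f1 - x1) - (f0 - x0) +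
      (x1 - x0 - (S : ℝ)⁻¹ • (a1 - a0)) + (S : ℝ)⁻¹ • ((a1 - b1) - (a0 - b0)) := by
    module
  rw [hsplit]
  have n1 : ‖(S : ℝ)⁻¹ • ((a1 - b1) - (a0 - b0))‖ ≤ 2 * (L * (d * stepLen S r (j + 1))) := by
    rw [norm_smul, norm_inv, Real.norm_of_nonneg hSR.le, inv_mul_le_iff₀ hSR]
    refine (norm_sub_le _ _).trans ((add_le_add g1 g0).trans (le_of_eq ?_))
    rw [hdiv]; ring
  have n2 : S * (L / S * stepLen S r (j + 1)) = L * stepLen S r (j + 1) := by field_simp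
  rw [n2] at hvar'
  have n3 : L * stepLen S r (j + 1) ≤ L * (d * stepLen S r (j + 1)) := by
    gcongr
    nlinarith
  refine (norm_add_le _ _).trans ?_
  have n4 := norm_add_le ((f1 - x1) - (f0 - x0)) (x1 - x0 - (S : ℝ)⁻¹ • (a1 - a0))
  have n5 := norm_sub_le (f1 - x1) (f0 - x0)
  linarith

end NearConstancy

section Mass

variable {d : ℕ}

lemma measurableSet_unitCube : MeasurableSet (unitCube d) := by
  have : unitCube d = ⋂ k : Fin d, {x : Euc d | x k ∈ Icc (0 : ℝ) 1} := by
    ext; simp [unitCube]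
  rw [this]
  exact MeasurableSet.iInter fun k => measurable_coord k measurableSet_Icc

lemma volume_image_eq_of_map_eq {f : Euc d → Euc d} {ρ : Euc d → ENNReal}
    (hcont : ContinuousOn f (unitCube d)) (hinj : InjOn f (unitCube d))
    (hmap : Measure.map f ((volume.restrict (unitCube d)).withDensity ρ) =
      volume.restrict (f '' unitCube d)) {A : Set (Euc d)} (hA : MeasurableSet A)
    (hAC : A ⊆ unitCube d) : volume (f '' A) = ∫⁻ x in A, ρ x := by
  have hC := measurableSet_unitCube (d := d)
  have hfA : MeasurableSet (f '' A) :=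
    hA.image_of_continuousOn_injOn (hcont.mono hAC) (hinj.mono hAC)
  have hfm : AEMeasurable f ((volume.restrict (unitCube d)).withDensity ρ) :=
    (hcont.aemeasurable hC).mono_ac (withDensity_absolutelyContinuous _ _)
  have h1 : volume.restrict (f '' unitCube d) (f '' A) = volume (f '' A) := by
    rw [Measure.restrict_apply hfA, inter_eq_left.2 (image_mono hAC)]
  rw [← h1, ← hmap, Measure.map_apply_of_aemeasurable hfm hfA]
  have h2 : f ⁻¹' (f '' A) =ᵐ[(volume.restrict (unitCube d)).withDensity ρ] A := by
    refine (withDensity_absolutelyContinuous _ _).ae_eq ?_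
    rw [Filter.eventuallyEq_set, ae_restrict_iff' hC]
    refine Eventually.of_forall fun x hx => ⟨?_, fun h => ⟨x, h, rfl⟩⟩
    rintro ⟨y, hy, hyx⟩
    rwa [← hinj (hAC hy) hx hyx]
  rw [measure_congr h2, withDensity_apply _ hA, Measure.restrict_restrict hA,
    inter_eq_left.2 hAC]

lemma setLIntegral_le_of_image_subset {f : Euc d → Euc d} {ρ : Euc d → ENNReal}
    (hcont : ContinuousOn f (unitCube d)) (hinj : InjOn f (unitCube d))
    (hmap : Measure.map f ((volume.restrict (unitCube d)).withDensity ρ) =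
      volume.restrict (f '' unitCube d)) {A T : Set (Euc d)} (hA : MeasurableSet A)
    (hAC : A ⊆ unitCube d) (hT : MeasurableSet T) (hTC : T ⊆ unitCube d) (w : Euc d)
    (h : ∀ y ∈ A, f y + w ∈ f '' T) : ∫⁻ x in A, ρ x ≤ ∫⁻ x in T, ρ x := by
  rw [← volume_image_eq_of_map_eq hcont hinj hmap hA hAC,
    ← volume_image_eq_of_map_eq hcont hinj hmap hT hTC,
    ← measure_preimage_add_right volume (-w) (f '' A)]
  refine measure_mono ?_
  rintro z ⟨y, hy, hyz⟩
  have := h y hy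
  rwa [hyz, neg_add_cancel_right] at this

lemma abs_sub_apply_le_dist (x y : Euc d) (k : Fin d) : |x k - y k| ≤ dist x y := by
  rw [dist_eq_norm, ← Real.norm_eq_abs, ← PiLp.sub_apply]
  exact PiLp.norm_apply_le _ k

/-- If `f z - f y` is close to `w`, then `f y + w` is the image of a point near `z`. -/
lemma add_mem_image_of_norm_sub_le {f : Euc d → Euc d} {τ l : ℝ} (hτ : 0 ≤ τ)
    (hl : l < 1 / 8) (hcont : ContinuousOn f (unitCube d)) (hinj : InjOn f (unitCube d))
    (hinv : ∀ x ∈ unitCube d, ∀ y ∈ unitCube d, dist (f x) (f y) ≤ τ → dist x y ≤ l)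
    {y z w : Euc d} (hz : ∀ k, z k ∈ Icc (1 / 4 : ℝ) (3 / 4)) (h : ‖f z - f y - w‖ ≤ τ) :
    ∃ x ∈ unitCube d, dist x z ≤ l ∧ f x = f y + w := by
  have hzC := mem_unitCube_of_mem_Icc hz
  have hball : closedBall z (1 / 8) ⊆ unitCube d := by
    intro x hx k
    have h1 := (abs_sub_apply_le_dist x z k).trans (mem_closedBall.1 hx)
    rw [abs_le] at h1
    have h2 := hz k
    exact ⟨by linarith [h1.1, h2.1], by linarith [h1.2, h2.2]⟩
  have hsub := closedBall_subset_image_closedBall (x := z) (R := 1 / 8) (by norm_num) hτ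
    (hcont.mono hball) (hinj.mono hball) fun b hb => by
      by_contra! hle
      have := hinv b (hball (sphere_subset_closedBall hb)) z hzC hle
      rw [mem_sphere.1 hb] at this
      linarith
  have hmem : f y + w ∈ closedBall (f z) τ := by
    rw [mem_closedBall, dist_comm, dist_eq_norm, ← sub_sub]
    exact h
  obtain ⟨x, hx, hxw⟩ := hsub hmem
  refine ⟨x, hball hx, hinv x (hball hx) z hzC ?_, hxw⟩
  rw [hxw]
  exact mem_closedBall.1 hmem

/-- The half open cube of side `s` with corner `q`. -/
def cubeAt (q : Euc d) (s : ℝ) : Set (Euc d) := {x | ∀ k, x k ∈ Ico (q k) (q k + s)}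

lemma measurableSet_cubeAt (q : Euc d) (s : ℝ) : MeasurableSet (cubeAt q s) :=
  measurableSet_box _ _

lemma volume_cubeAt (q : Euc d) {s : ℝ} (hs : 0 ≤ s) :
    volume (cubeAt q s) = ENNReal.ofReal (s ^ d) := by
  rw [cubeAt, volume_box]
  simp [ENNReal.ofReal_pow hs]

lemma volumeReal_cubeAt (q : Euc d) {s : ℝ} (hs : 0 ≤ s) : volume.real (cubeAt q s) = s ^ d := by
  rw [measureReal_def, volume_cubeAt q hs, ENNReal.toReal_ofReal (by positivity)]

lemma add_mem_cubeAt_iff (q u : Euc d) (s : ℝ) : q + u ∈ cubeAt q s ↔ u ∈ halfOpenCube d s := by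
  simp [cubeAt, halfOpenCube]

lemma setIntegral_cubeAt (h : Euc d → ℝ) (q : Euc d) (s : ℝ) :
    ∫ x in cubeAt q s, h x = ∫ u in halfOpenCube d s, h (q + u) := by
  rw [← (measurePreserving_add_left volume q).setIntegral_preimage_emb
    (measurableEmbedding_addLeft q)]
  congr 2
  ext u
  exact add_mem_cubeAt_iff q u s

lemma integrableOn_cubeAt_iff (h : Euc d → ℝ) (q : Euc d) (s : ℝ) :
    IntegrableOn h (cubeAt q s) ↔ IntegrableOn (fun u => h (q + u)) (halfOpenCube d s) := by
  rw [← (measurePreserving_add_left volume q).integrableOn_comp_preimage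
    (measurableEmbedding_addLeft q)]
  have : (fun u => q + u) ⁻¹' cubeAt q s = halfOpenCube d s := by
    ext u
    exact add_mem_cubeAt_iff q u s
  rw [this]
  rfl

/-- Comparison of the masses of two neighbouring cubes on which the density oscillates. -/
lemma oscillation_le_of_setLIntegral_le {ρ g ψ : Euc d → ℝ} {B ε s l : ℝ} {q v : Euc d}
    {N T : Set (Euc d)} (hε : 0 ≤ ε) (hs : 0 ≤ s)
    (hρC : IntegrableOn ρ (unitCube d)) (hρ0 : ∀ᵐ x ∂volume.restrict (unitCube d), 0 ≤ ρ x)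
    (hρB : ∀ᵐ x ∂volume.restrict (unitCube d), ρ x ≤ B)
    (hlow : ∀ᵐ x ∂volume.restrict (unitCube d), g x + ε * ψ x - ε / 4 ≤ ρ x)
    (hup : ∀ᵐ x ∂volume.restrict (unitCube d), ρ x ≤ g x + ε * ψ x + ε / 4)
    (hg : Integrable g) (hψ : Measurable ψ) (hψ1 : ∀ x, |ψ x| = 1)
    (hQ : cubeAt q s ⊆ unitCube d) (hT : T ⊆ unitCube d)
    (hQT : cubeAt (q + v) s ⊆ T) (hTl : volume T ≤ ENNReal.ofReal ((s + 2 * l) ^ d))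
    (hl : 0 ≤ l)
    (hmass : ∫⁻ x in cubeAt q s, ENNReal.ofReal (ρ x) ≤ ∫⁻ x in T, ENNReal.ofReal (ρ x))
    (hosc : ∫⁻ u in halfOpenCube d s, ‖g (q + u + v) - g (q + u)‖ₑ ≤
      ENNReal.ofReal (s ^ d * (ε / 2)))
    (hN : MeasurableSet N) (hNs : volume N ≤ ENNReal.ofReal (s ^ d / 8))
    (h1 : ∀ u ∈ halfOpenCube d s, u ∉ N → ψ (q + u) = 1)
    (h2 : ∀ u ∈ halfOpenCube d s, u ∉ N → ψ (q + v + u) = -1) (hB : 0 ≤ B) :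
    ε / 2 * s ^ d ≤ B * ((s + 2 * l) ^ d - s ^ d) := by
  have hQ' := hQT.trans hT
  have hHm := measurableSet_halfOpenCube (d := d) s
  have hHv : volume.real (halfOpenCube d s) = s ^ d := by
    rw [measureReal_def, volume_halfOpenCube hs, ENNReal.toReal_ofReal (by positivity)]
  have hHf : volume (halfOpenCube d s) ≠ ⊤ := by
    rw [volume_halfOpenCube hs]; exact ENNReal.ofReal_ne_top
  have hae : ∀ {A : Set (Euc d)} {P : Euc d → Prop}, A ⊆ unitCube d →
      (∀ᵐ x ∂volume.restrict (unitCube d), P x) → ∀ᵐ x ∂volume.restrict A, P x :=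
    fun hA h => ae_mono (Measure.restrict_mono hA le_rfl) h
  have hTf : volume T ≠ ⊤ := ne_top_of_le_ne_top ENNReal.ofReal_ne_top hTl
  have hTr : volume.real T ≤ (s + 2 * l) ^ d :=
    ENNReal.toReal_le_of_le_ofReal (by positivity) hTl
  -- passing to integrals of real valued functions
  have hmass' : ∫ x in cubeAt q s, ρ x ≤ ∫ x in T, ρ x := by
    rw [← ENNReal.ofReal_le_ofReal_iff (integral_nonneg_of_ae (hae hT hρ0)),
      ofReal_integral_eq_lintegral_ofReal (hρC.mono_set hQ) (hae hQ hρ0),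
      ofReal_integral_eq_lintegral_ofReal (hρC.mono_set hT) (hae hT hρ0)]
    exact hmass
  have hTQ : ∫ x in T, ρ x ≤ (∫ x in cubeAt (q + v) s, ρ x) + B * ((s + 2 * l) ^ d - s ^ d) := by
    have hdiff : ∫ x in T \ cubeAt (q + v) s, ρ x =
        (∫ x in T, ρ x) - ∫ x in cubeAt (q + v) s, ρ x :=
          setIntegral_sdiff (measurableSet_cubeAt (q + v) s) (hρC.mono_set hT) hQT
    have hle : ∫ x in T \ cubeAt (q + v) s, ρ x ≤ ∫ _x in T \ cubeAt (q + v) s, B :=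
      integral_mono_ae (hρC.mono_set (sdiff_subset.trans hT))
        (integrableOn_const (measure_ne_top_of_subset sdiff_subset hTf))
        (hae (sdiff_subset.trans hT) hρB)
    rw [setIntegral_const, smul_eq_mul, measureReal_sdiff hQT (measurableSet_cubeAt _ _) ,
      volumeReal_cubeAt _ hs] at hle
    have := mul_le_mul_of_nonneg_left hTr hB
    linarith
  have hψi : ∀ A : Set (Euc d), volume A ≠ ⊤ → IntegrableOn ψ A := fun A hA =>
    Measure.integrableOn_of_bounded (M := 1) hA hψ.aestronglyMeasurable
      (Eventually.of_forall fun x => (hψ1 x).le)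
  have hcube : ∀ q : Euc d, volume (cubeAt q s) ≠ ⊤ := fun q => by
    rw [volume_cubeAt q hs]; exact ENNReal.ofReal_ne_top
  have hlint : ∀ (q : Euc d) (b : ℝ), IntegrableOn (fun x => g x + ε * ψ x + b) (cubeAt q s) :=
    fun q b => (hg.integrableOn.add ((hψi _ (hcube q)).const_mul ε)).add
      (integrableOn_const (hcube q))
  have hQlow : ∫ x in cubeAt q s, (g x + ε * ψ x + -(ε / 4)) ≤ ∫ x in cubeAt q s, ρ x :=
    integral_mono_ae (hlint _ _) (hρC.mono_set hQ) (hae hQ hlow)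
  have hQup : ∫ x in cubeAt (q + v) s, ρ x ≤ ∫ x in cubeAt (q + v) s, (g x + ε * ψ x + ε / 4) :=
    integral_mono_ae (hρC.mono_set hQ') (hlint _ _) (hae hQ' hup)
  have i1 := (integrableOn_cubeAt_iff _ _ _).1 (hlint q (-(ε / 4)))
  have i2 := (integrableOn_cubeAt_iff _ _ _).1 (hlint (q + v) (ε / 4))
  rw [setIntegral_cubeAt] at hQlow
  rw [setIntegral_cubeAt (fun x => g x + ε * ψ x + ε / 4)] at hQup
  have ig : IntegrableOn (fun u => |g (q + u + v) - g (q + u)|) (halfOpenCube d s) := by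
    have hg1 : Integrable fun u => g (q + u) := hg.comp_add_left q
    have hg2 : Integrable fun u => g (q + u + v) := by
      simpa only [add_assoc, add_comm v] using hg.comp_add_left (q + v)
    exact ((hg2.sub hg1).abs).integrableOn
  have ic : IntegrableOn (fun _ : Euc d => 3 / 2 * ε) (halfOpenCube d s) := integrableOn_const hHf
  have ia : IntegrableOn (fun u => 3 / 2 * ε - |g (q + u + v) - g (q + u)|)
      (halfOpenCube d s) := ic.sub ig
  have iN : IntegrableOn (N.indicator fun _ => (4 * ε : ℝ)) (halfOpenCube d s) :=
    (integrableOn_const hHf).indicator hN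
  have hpt : ∀ u ∈ halfOpenCube d s, 3 / 2 * ε - |g (q + u + v) - g (q + u)| -
      N.indicator (fun _ => (4 * ε : ℝ)) u ≤
      (g (q + u) + ε * ψ (q + u) + -(ε / 4)) - (g (q + v + u) + ε * ψ (q + v + u) + ε / 4) := by
    intro u hu
    have hc : q + u + v = q + v + u := by abel
    rw [hc]
    have hgle := le_abs_self (g (q + v + u) - g (q + u))
    by_cases huN : u ∈ N
    · rw [indicator_of_mem huN]
      have a1 := neg_le_of_abs_le (hψ1 (q + u)).le
      have a2 := le_of_abs_le (hψ1 (q + v + u)).le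
      nlinarith
    · rw [indicator_of_notMem huN, h1 u hu huN, h2 u hu huN]
      linarith
  have hint := setIntegral_mono_on (ia.sub iN) (i1.sub i2) hHm hpt
  simp only [Pi.sub_apply] at hint
  rw [integral_sub i1 i2] at hint
  have hsplit : ∫ u in halfOpenCube d s, (3 / 2 * ε - |g (q + u + v) - g (q + u)| -
      N.indicator (fun _ => (4 * ε : ℝ)) u) = 3 / 2 * ε * s ^ d -
      (∫ u in halfOpenCube d s, |g (q + u + v) - g (q + u)|) -
      4 * ε * volume.real (N ∩ halfOpenCube d s) := by
    rw [integral_sub ia iN,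
      integral_sub ic ig, setIntegral_const, integral_indicator hN,
      setIntegral_const, hHv, measureReal_restrict_apply hN]
    simp only [smul_eq_mul]
    ring
  have hosc' : ∫ u in halfOpenCube d s, |g (q + u + v) - g (q + u)| ≤ s ^ d * (ε / 2) := by
    rw [← ENNReal.ofReal_le_ofReal_iff (by positivity),
      ofReal_integral_eq_lintegral_ofReal ig (Eventually.of_forall fun _ => abs_nonneg _)]
    simpa only [Real.enorm_eq_ofReal_abs] using hosc
  have hNr : volume.real (N ∩ halfOpenCube d s) ≤ s ^ d / 8 :=
    ENNReal.toReal_le_of_le_ofReal (by positivity) ((measure_mono inter_subset_left).trans hNs)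
  have hNr' : 4 * ε * volume.real (N ∩ halfOpenCube d s) ≤ 4 * ε * (s ^ d / 8) := by gcongr
  linarith

end Mass

section Cell

variable {d : ℕ} {i₀ : Fin d} {S M : ℕ} {r : ℝ}

/-- The mass comparison on a cell where the difference of `f` under the shift is almost constant. -/
lemma oscillation_le_of_cell {f : Euc d → Euc d} {L : ℝ} {k₁ : Fin d} (hk₁ : k₁ ≠ i₀) (hS : 8 ≤ S)
    (hr : 0 < r) (hr' : r ≤ 1 / 16) (hdr : d * r ≤ 1 / 8) {p : Euc d}
    (hp : ∀ k, p k ∈ Ico (1 / 4 : ℝ) (1 / 2)) (hL1 : 1 ≤ L) (hLS : 10 * d * L ^ 2 ≤ S)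
    (hL : ∀ x ∈ unitCube d, ∀ y ∈ unitCube d, ∀ t, stepLen S r M ≤ t → t ≤ 1 / 8 →
      dist x y ≤ t → dist (f x) (f y) ≤ L * t)
    (hinv : ∀ x ∈ unitCube d, ∀ y ∈ unitCube d, ∀ t, stepLen S r M ≤ t → t ≤ 1 / 8 →
      dist (f x) (f y) ≤ t → dist x y ≤ L * t)
    (hcont : ContinuousOn f (unitCube d)) (hinj : InjOn f (unitCube d))
    {ρ g : Euc d → ℝ} {B ε : ℝ} (hε : 0 ≤ ε) (hB : 0 ≤ B)
    (hmap : Measure.map f ((volume.restrict (unitCube d)).withDensity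
      fun x => ENNReal.ofReal (ρ x)) = volume.restrict (f '' unitCube d))
    (hρC : IntegrableOn ρ (unitCube d)) (hρ0 : ∀ᵐ x ∂volume.restrict (unitCube d), 0 ≤ ρ x)
    (hρB : ∀ᵐ x ∂volume.restrict (unitCube d), ρ x ≤ B)
    (hlow : ∀ᵐ x ∂volume.restrict (unitCube d),
      g x + ε * multiscaleSign i₀ S r M 0 (x - p) - ε / 4 ≤ ρ x)
    (hup : ∀ᵐ x ∂volume.restrict (unitCube d),
      ρ x ≤ g x + ε * multiscaleSign i₀ S r M 0 (x - p) + ε / 4)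
    (hg : Integrable g)
    (a : Fin M → Fin d → Fin S) (j : Fin M) {i : ℕ} (hi : i < (S ^ 2) ^ (j : ℕ))
    (hc : ∀ v : Fin d → Fin S, ∃ c : Fin M → Fin d → Fin S,
      (∀ k : Fin M, (k : ℕ) < j → c k = a k) ∧ c j = v ∧
      incrementVariance (fun t => f (p + (digitOffset i₀ r c M +
        t • EuclideanSpace.single i₀ (1 : ℝ)))) (S ^ 2) (stepLen S r j) i ≤
        (L / S * stepLen S r (j + 1)) ^ 2)
    (hosc : ∫⁻ u in halfOpenCube d (stepLen S r j / S),
      ‖g (p + (digitOffset i₀ r a j + (i * stepLen S r j) • EuclideanSpace.single i₀ (1 : ℝ)) + u +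
        (stepLen S r j / S) • EuclideanSpace.single i₀ (1 : ℝ)) -
      g (p + (digitOffset i₀ r a j + (i * stepLen S r j) • EuclideanSpace.single i₀ (1 : ℝ)) + u)‖ₑ
      ≤ ENNReal.ofReal ((stepLen S r j / S) ^ d * (ε / 2))) :
    ∃ s l : ℝ, 0 < s ∧ 0 ≤ l ∧ l * S = 5 * d * L ^ 2 * s ∧
      ε / 2 * s ^ d ≤ B * ((s + 2 * l) ^ d - s ^ d) := by
  have hS0 : 0 < S := by omega
  have hSR : (0 : ℝ) < S := by positivity
  have hS8 : (8 : ℝ) ≤ S := by exact_mod_cast hS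
  have hd : 1 ≤ d := Fin.pos i₀
  have hd1 : (1 : ℝ) ≤ d := by exact_mod_cast hd
  have hq := stepLen_pos hS0 hr (j + 1)
  have hsj := stepLen_pos hS0 hr j
  have hdiv := stepLen_div_eq (r := r) hS0 j
  have hqM : stepLen S r M ≤ stepLen S r (j + 1) := stepLen_anti hS0 hr j.2
  have hsS : stepLen S r j / S ≤ stepLen S r j := div_le_self hsj.le (by linarith)
  have hsr : stepLen S r j ≤ r := by
    have := stepLen_anti hS0 hr (Nat.zero_le j)
    rwa [stepLen_zero] at this
  have hir := succ_mul_stepLen_le hS0 hr hi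
  have hi0 : (0 : ℝ) ≤ i := by positivity
  obtain ⟨w, hw⟩ := exists_forall_cell_norm_le hd (by omega) hr hr' hp (by linarith)
    (fun x hx y hy t h1 h2 => hL x hx y hy t h1 (h2.trans hdr)) a j hi hc
  set e : Euc d := EuclideanSpace.single i₀ (1 : ℝ) with he
  set s := stepLen S r j / S with hs_def
  have hs : 0 < s := by positivity
  set τ := 5 * d * L * stepLen S r (j + 1) with hτ_def
  have hlS : L * τ * S = 5 * d * L ^ 2 * s := by rw [hτ_def, hdiv]; ring
  have hl0 : 0 ≤ L * τ := by positivity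
  have hl : L * τ ≤ s / 2 := by
    have : L * τ * S ≤ s / 2 * S := by
      rw [hlS]; nlinarith
    exact le_of_mul_le_mul_right this hSR
  have hτM : stepLen S r M ≤ τ := by
    refine hqM.trans (le_mul_of_one_le_left hq.le ?_)
    nlinarith
  have hτ0 : 0 ≤ τ := by positivity
  have hτl : τ ≤ L * τ := le_mul_of_one_le_left hτ0 hL1
  set q := p + (digitOffset i₀ r a j + (i * stepLen S r j) • e) with hq_def
  have hu' : ∀ u ∈ halfOpenCube d s, ∀ k, u k ∈ Icc 0 r := fun u hu k =>
    ⟨(hu k).1, by linarith [(hu k).2]⟩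
  have hQ0 : ∀ u : Euc d, q + u = p + (digitOffset i₀ r a j + (i * stepLen S r j) • e + u) :=
    fun u => by rw [hq_def]; abel
  have hQ1 : ∀ u : Euc d, q + s • e + u =
      p + (digitOffset i₀ r a j + (i * stepLen S r j + s) • e + u) :=
    fun u => by rw [hq_def, add_smul]; abel
  have hm0 : ∀ u ∈ halfOpenCube d s, ∀ k, (q + u) k ∈ Icc (1 / 4 : ℝ) (3 / 4) := fun u hu => by
    rw [hQ0]
    exact add_offset_apply_mem hS0 hr hr' hp a j ⟨by positivity, by linarith⟩ (hu' u hu)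
  have hm1 : ∀ u ∈ halfOpenCube d s, ∀ k, (q + s • e + u) k ∈ Icc (1 / 4 : ℝ) (3 / 4) :=
    fun u hu => by
      rw [hQ1]
      exact add_offset_apply_mem hS0 hr hr' hp a j ⟨by positivity, by linarith⟩ (hu' u hu)
  have hcube : ∀ (q' : Euc d), (∀ u ∈ halfOpenCube d s, ∀ k,
      (q' + u) k ∈ Icc (1 / 4 : ℝ) (3 / 4)) → cubeAt q' s ⊆ unitCube d := by
    intro q' h x hx
    have hx' : x - q' ∈ halfOpenCube d s := by
      rwa [← add_mem_cubeAt_iff q', add_sub_cancel]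
    have := mem_unitCube_of_mem_Icc (h _ hx')
    rwa [add_sub_cancel] at this
  set T : Set (Euc d) := {x | ∀ k, x k ∈ Ico ((q + s • e) k - L * τ) ((q + s • e) k + s + L * τ)} ∩
    unitCube d with hT_def
  have hTm : MeasurableSet T := (measurableSet_box _ _).inter measurableSet_unitCube
  have hTv : volume T ≤ ENNReal.ofReal ((s + 2 * (L * τ)) ^ d) := by
    refine (measure_mono inter_subset_left).trans (le_of_eq ?_)
    rw [volume_box, Finset.prod_congr rfl fun k _ => show ENNReal.ofReal
      ((q + s • e) k + s + L * τ - ((q + s • e) k - L * τ)) = ENNReal.ofReal (s + 2 * (L * τ)) by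
        congr 1; ring, Finset.prod_const, Finset.card_univ, Fintype.card_fin,
      ENNReal.ofReal_pow (by positivity)]
  have hmemT : ∀ x ∈ unitCube d, ∀ u ∈ halfOpenCube d s, dist x (q + s • e + u) ≤ L * τ →
      x ∈ T := by
    refine fun x hx u hu hxu => ⟨fun k => ?_, hx⟩
    have h1 := (abs_sub_apply_le_dist x _ k).trans hxu
    rw [show (q + s • e + u) k = (q + s • e) k + u k from rfl, abs_le] at h1
    have h2 := hu k
    exact ⟨by linarith [h1.1, h2.1], by linarith [h1.2, h2.2]⟩
  have hQT : cubeAt (q + s • e) s ⊆ T := fun x hx => by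
    have hx' : x - (q + s • e) ∈ halfOpenCube d s := by
      rwa [← add_mem_cubeAt_iff (q + s • e), add_sub_cancel]
    refine hmemT x (hcube _ hm1 hx) _ hx' ?_
    rwa [add_sub_cancel, dist_self]
  have hmass := setLIntegral_le_of_image_subset hcont hinj hmap (measurableSet_cubeAt q s)
    (hcube q hm0) hTm inter_subset_right w fun y hy => by
      have hy' : y - q ∈ halfOpenCube d s := by
        rwa [← add_mem_cubeAt_iff q, add_sub_cancel]
      have hwy := hw _ hy'
      rw [← hQ0, ← hQ1, add_sub_cancel] at hwy
      obtain ⟨x, hx, hxz, hfx⟩ := add_mem_image_of_norm_sub_le hτ0 (l := L * τ) (by linarith)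
        hcont hinj (fun x hx y hy => hinv x hx y hy τ hτM (by linarith)) (hm1 _ hy') hwy
      exact ⟨x, hmemT x hx _ hy' hxz, hfx⟩
  have hNv := volume_slabCube_le (d := d) hs.le hS0 hdiv k₁
  have hnotmem : ∀ u ∈ halfOpenCube d s, u ∉ slabCube d s (stepLen S r (j + 1)) S k₁ → ∀ t : ℝ,
      multiscaleSign i₀ S r M 0 (digitOffset i₀ r a j + t • e + u) =
        signAt i₀ S r j (digitOffset i₀ r a j + t • e + u) := fun u hu huN t =>
    multiscaleSign_eq_signAt j.2 (fun l _ hlj => mem_thinSet_of_mem_cell hS0 hr a hlj hu t)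
      fun h => huN ⟨hu, mem_slab_of_mem_thinSet hS0 hr a hu t hk₁ h⟩
  refine ⟨s, L * τ, hs, hl0, hlS, oscillation_le_of_setLIntegral_le (q := q) (v := s • e) (T := T)
    (ψ := fun x => multiscaleSign i₀ S r M 0 (x - p))
    (N := slabCube d s (stepLen S r (j + 1)) S k₁) hε hs.le hρC hρ0 hρB hlow hup hg
    ((measurable_multiscaleSign M 0).comp (measurable_sub_const p))
    (fun x => abs_multiscaleSign M 0 _) (hcube q hm0) inter_subset_right hQT hTv hl0 hmass hosc
    (measurableSet_slabCube _ _ _ _) (hNv.trans (ENNReal.ofReal_le_ofReal ?_)) ?_ ?_ hB⟩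
  · gcongr
  · intro u hu huN
    rw [hQ0, add_sub_cancel_left, hnotmem u hu huN]
    exact signAt_eq_one (by omega) hr a i j hu
  · intro u hu huN
    rw [hQ1, add_sub_cancel_left, hnotmem u hu huN]
    exact signAt_eq_neg_one (by omega) hr a i j hu

end Cell

section Contradiction

variable {d : ℕ} {i₀ : Fin d} {S : ℕ} {r : ℝ}

lemma one_add_pow_le {u : ℝ} (hu : 0 ≤ u) (hu1 : u ≤ 1) (n : ℕ) :
    (1 + u) ^ n ≤ 1 + (2 ^ n - 1) * u := by
  induction n with
  | zero => simp
  | succ n ih =>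
    have h2 : (1 + u) ^ n ≤ 2 ^ n := by gcongr; linarith
    have := mul_le_mul_of_nonneg_left h2 hu
    rw [pow_succ, pow_succ]
    linarith

lemma add_pow_sub_pow_le {s l : ℝ} (hs : 0 < s) (hl : 0 ≤ l) (hls : l ≤ s) (n : ℕ) :
    (s + l) ^ n - s ^ n ≤ 2 ^ n * (l / s) * s ^ n := by
  have hu : 0 ≤ l / s := by positivity
  have h1 := one_add_pow_le hu ((div_le_one hs).2 hls) n
  have h2 : (s + l) ^ n = (1 + l / s) ^ n * s ^ n := by
    rw [← mul_pow]
    congr 1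
    field_simp
  rw [h2]
  have h3 := mul_le_mul_of_nonneg_right h1 (pow_nonneg hs.le n)
  have h4 := mul_nonneg hu (pow_nonneg hs.le n)
  linarith

/-- The offset of the cell with index `n`. -/
def cellOffset (i₀ : Fin d) (r : ℝ) {M : ℕ} (n : CellIndex M (S ^ 2) (Fin d → Fin S)) : Euc d :=
  digitOffset i₀ r n.2.1 n.1 + ((n.2.2 : ℕ) * stepLen S r n.1) • EuclideanSpace.single i₀ (1 : ℝ)

lemma false_of_oscillation {f : Euc d → Euc d} {L : ℝ} {k₁ : Fin d} (hk₁ : k₁ ≠ i₀) (hS : 8 ≤ S)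
    {M : ℕ} (hM : M = 2 * S ^ (d + 4))
    (hr : 0 < r) (hr' : r ≤ 1 / 16) (hdr : d * r ≤ 1 / 8) {p : Euc d}
    (hp : ∀ k, p k ∈ Ico (1 / 4 : ℝ) (1 / 2)) (hL1 : 1 ≤ L) (hLS : 10 * d * L ^ 2 ≤ S)
    (hL : ∀ x ∈ unitCube d, ∀ y ∈ unitCube d, ∀ t, stepLen S r M ≤ t → t ≤ 1 / 8 →
      dist x y ≤ t → dist (f x) (f y) ≤ L * t)
    (hinv : ∀ x ∈ unitCube d, ∀ y ∈ unitCube d, ∀ t, stepLen S r M ≤ t → t ≤ 1 / 8 →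
      dist (f x) (f y) ≤ t → dist x y ≤ L * t)
    (hcont : ContinuousOn f (unitCube d)) (hinj : InjOn f (unitCube d))
    {ρ g : Euc d → ℝ} {B ε : ℝ} (hε : 0 < ε) (hB : 0 ≤ B)
    (hBS : 20 * d * 2 ^ d * B * L ^ 2 < ε * S)
    (hmap : Measure.map f ((volume.restrict (unitCube d)).withDensity
      fun x => ENNReal.ofReal (ρ x)) = volume.restrict (f '' unitCube d))
    (hρC : IntegrableOn ρ (unitCube d)) (hρ0 : ∀ᵐ x ∂volume.restrict (unitCube d), 0 ≤ ρ x)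
    (hρB : ∀ᵐ x ∂volume.restrict (unitCube d), ρ x ≤ B)
    (hlow : ∀ᵐ x ∂volume.restrict (unitCube d),
      g x + ε * multiscaleSign i₀ S r M 0 (x - p) - ε / 4 ≤ ρ x)
    (hup : ∀ᵐ x ∂volume.restrict (unitCube d),
      ρ x ≤ g x + ε * multiscaleSign i₀ S r M 0 (x - p) + ε / 4)
    (hg : Integrable g)
    (hosc : ∑ n : CellIndex M (S ^ 2) (Fin d → Fin S), ENNReal.ofReal (cellWeight n) *
      shiftMean g (EuclideanSpace.single i₀ (1 : ℝ)) (stepLen S r n.1 / S)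
        (p + cellOffset i₀ r n) ≤
      ENNReal.ofReal ((∑ n : CellIndex M (S ^ 2) (Fin d → Fin S), cellWeight n) * (ε / 4))) :
    False := by
  have hS0 : 0 < S := by omega
  have hSR : (0 : ℝ) < S := by positivity
  have : NeZero S := ⟨hS0.ne'⟩
  have hMR : (M : ℝ) = 2 * (S : ℝ) ^ (d + 4) := by rw [hM]; push_cast; rfl
  have hM0 : 0 < M := by rw [hM]; positivity
  have hcw : ∀ n : CellIndex M (S ^ 2) (Fin d → Fin S), 0 < cellWeight n := fun n => by
    unfold cellWeight; positivity
  have hcard : (Fintype.card (Fin d → Fin S) : ℝ) = (S : ℝ) ^ d := by simp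
  have hfin : ∀ n : CellIndex M (S ^ 2) (Fin d → Fin S), shiftMean g
      (EuclideanSpace.single i₀ (1 : ℝ)) (stepLen S r n.1 / S) (p + cellOffset i₀ r n) ≠ ⊤ := by
    intro n htop
    have h1 := (ENNReal.sum_lt_top.1 (hosc.trans_lt ENNReal.ofReal_lt_top)) n (Finset.mem_univ n)
    rw [htop, ENNReal.mul_top (ENNReal.ofReal_pos.2 (hcw n)).ne'] at h1
    exact lt_irrefl _ h1
  have hsum : ∑ n : CellIndex M (S ^ 2) (Fin d → Fin S), cellWeight n *
      (shiftMean g (EuclideanSpace.single i₀ (1 : ℝ)) (stepLen S r n.1 / S)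
        (p + cellOffset i₀ r n)).toReal ≤
      M * (Fintype.card (Fin d → Fin S) : ℝ) ^ M * (ε / 4) := by
    rw [← sum_cellWeight (R := S ^ 2) (by positivity)]
    have h1 := ENNReal.toReal_le_of_le_ofReal
      (mul_nonneg (Finset.sum_nonneg fun n _ => (hcw n).le) (by positivity)) hosc
    rw [ENNReal.toReal_sum fun n _ => ENNReal.mul_ne_top ENNReal.ofReal_ne_top (hfin n)] at h1
    simpa only [ENNReal.toReal_mul, ENNReal.toReal_ofReal (hcw _).le] using h1
  have hstep : ∀ j : ℕ, r / ((S ^ 2 : ℕ) : ℝ) ^ j = stepLen S r j := fun _ => rfl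
  have hrM := stepLen_pos hS0 hr M
  have hrMr : stepLen S r M ≤ r := by
    have := stepLen_anti hS0 hr (Nat.zero_le M)
    rwa [stepLen_zero] at this
  obtain ⟨n, hn, hc⟩ := exists_good_cell (R := S ^ 2) (M := M) (V := Fin d → Fin S)
    (by positivity) hM0
    (fun c t => f (p + (digitOffset i₀ r c M + t • EuclideanSpace.single i₀ (1 : ℝ))))
    hr (L := L) (by linarith) (fun a i hi => by
      have hir := succ_mul_stepLen_le hS0 hr hi
      rw [hstep, increment, ← dist_eq_norm]
      have hmem : ∀ t ∈ Icc 0 (2 * r),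
          p + (digitOffset i₀ r a M + t • EuclideanSpace.single i₀ (1 : ℝ)) ∈ unitCube d :=
        fun t ht => by
          have := add_offset_apply_mem (i₀ := i₀) hS0 hr hr' hp a M ht (u := 0)
            fun k => ⟨le_rfl, hr.le⟩
          rw [add_zero] at this
          exact mem_unitCube_of_mem_Icc this
      refine hL _ (hmem _ ⟨by positivity, ?_⟩) _ (hmem _ ⟨by positivity, ?_⟩) _ le_rfl
        (by linarith) ?_
      · push_cast; linarith
      · linarith
      · rw [dist_add_left, dist_add_left, dist_eq_norm, ← sub_smul, norm_smul,
          PiLp.norm_single, norm_one, mul_one, Real.norm_eq_abs]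
        push_cast
        rw [← sub_mul, add_sub_cancel_left, one_mul, abs_of_pos hrM])
    _ (fun n => ENNReal.toReal_nonneg) (by positivity : 0 < ε / 4) hsum
  have hs : 0 < stepLen S r n.1 / S := div_pos (stepLen_pos hS0 hr _) hSR
  obtain ⟨s, l, hs0, hl0, hlS, hle⟩ := oscillation_le_of_cell hk₁ hS hr hr' hdr hp hL1 hLS hL hinv
    hcont hinj hε.le hB hmap hρC hρ0 hρB hlow hup hg n.2.1 n.1 n.2.2.2 (fun v => by
      obtain ⟨c, h1, h2, h3⟩ := hc v
      refine ⟨c, h1, h2, h3.trans (le_of_eq ?_)⟩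
      rw [hstep, ← stepLen_succ_mul hS0, hcard, hMR]
      push_cast
      field_simp
      ring) (by
      have h1 : shiftMean g (EuclideanSpace.single i₀ (1 : ℝ)) (stepLen S r n.1 / S)
          (p + cellOffset i₀ r n) ≤ ENNReal.ofReal (ε / 2) := by
        rw [ENNReal.le_ofReal_iff_toReal_le (hfin n) (by positivity)]
        linarith
      rw [shiftMean, ENNReal.ofReal_inv_of_pos (by positivity)] at h1
      have h2 := (ENNReal.inv_mul_le_iff (ENNReal.ofReal_pos.2 (by positivity)).ne'
        ENNReal.ofReal_ne_top).1 h1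
      rw [← ENNReal.ofReal_mul (by positivity)] at h2
      exact h2)
  have hls : 2 * l ≤ s := by
    have : 2 * l * S ≤ s * S := by nlinarith
    exact le_of_mul_le_mul_right this hSR
  have hpow := add_pow_sub_pow_le hs0 (by positivity : 0 ≤ 2 * l) hls d
  have hquot : 2 * l / s = 10 * d * L ^ 2 / S := by
    field_simp
    linarith
  rw [hquot] at hpow
  have h1 := hle.trans (mul_le_mul_of_nonneg_left hpow hB)
  have h2 : ε / 2 ≤ B * (2 ^ d * (10 * d * L ^ 2 / S)) := by
    refine le_of_mul_le_mul_right (h1.trans (le_of_eq ?_)) (pow_pos hs0 d)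
    ring
  have h3 : ε / 2 * S ≤ B * (2 ^ d * (10 * d * L ^ 2)) := by
    refine (mul_le_mul_of_nonneg_right h2 hSR.le).trans (le_of_eq ?_)
    field_simp
  linarith

end Contradiction

section Parameters

lemma log_one_div_stepLen_le {S : ℕ} {r : ℝ} (hS : 1 ≤ S) (hr : 0 < r)
    (hrS : Real.log (1 / r) ≤ S) (d : ℕ) :
    Real.log (1 / stepLen S r (2 * S ^ (d + 4))) ≤ 5 * (S : ℝ) ^ (d + 5) := by
  have hS1 : (1 : ℝ) ≤ S := by exact_mod_cast hS
  have hS0 : (0 : ℝ) < S := by linarith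
  have hlog : Real.log S ≤ S := (Real.log_le_sub_one_of_pos hS0).trans (by linarith)
  have h1 : Real.log (1 / stepLen S r (2 * S ^ (d + 4))) =
      Real.log (1 / r) + 4 * (S : ℝ) ^ (d + 4) * Real.log S := by
    have h2 : 1 / stepLen S r (2 * S ^ (d + 4)) =
        1 / r * ((S : ℝ) ^ 2) ^ (2 * S ^ (d + 4)) := by
      unfold stepLen
      push_cast
      field_simp
    rw [h2, Real.log_mul (by positivity) (by positivity), Real.log_pow, Real.log_pow]
    push_cast
    ring
  have h3 : (S : ℝ) ≤ S ^ (d + 5) := le_self_pow₀ hS1 (by omega)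
  have h4 : 4 * (S : ℝ) ^ (d + 4) * Real.log S ≤ 4 * (S : ℝ) ^ (d + 4) * S := by gcongr
  rw [h1, pow_succ _ (d + 4)]
  rw [pow_succ _ (d + 4)] at h3
  linarith

lemma exists_scale {K r : ℝ} (d : ℕ) (hr : 0 < r) (c : ℝ) (hc : 0 ≤ c) :
    ∃ S : ℕ, 8 ≤ S ∧ ∀ α : ℝ, α = 1 / (4 * (d + 5)) →
      1 ≤ Real.log (1 / stepLen S r (2 * S ^ (d + 4))) →
      c * (K * Real.log (1 / stepLen S r (2 * S ^ (d + 4))) ^ α) ^ 2 < S := by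
  obtain ⟨S, hS⟩ := exists_nat_gt (max 8 (max (Real.log (1 / r)) ((c * (5 * K ^ 2)) ^ 2)))
  obtain ⟨h8, h⟩ := max_lt_iff.1 hS
  obtain ⟨hlog, hsq⟩ := max_lt_iff.1 h
  have hS0 : (0 : ℝ) < S := by linarith
  have hS8 : 8 ≤ S := by exact_mod_cast h8.le
  refine ⟨S, hS8, fun α hα hl => ?_⟩
  have hle := log_one_div_stepLen_le (by omega) hr hlog.le d
  set l := Real.log (1 / stepLen S r (2 * S ^ (d + 4)))
  have hα0 : 0 < α := by rw [hα]; positivity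
  have hα1 : 2 * α ≤ 1 := by
    rw [hα, mul_one_div, div_le_one (by positivity)]
    have : (0 : ℝ) ≤ d := by positivity
    linarith
  have h1 : (l ^ α) ^ 2 ≤ 5 * √S := by
    rw [← Real.rpow_natCast, ← Real.rpow_mul (by linarith), mul_comm]
    push_cast
    calc l ^ (2 * α) ≤ (5 * (S : ℝ) ^ (d + 5)) ^ (2 * α) := by gcongr
      _ = 5 ^ (2 * α) * ((S : ℝ) ^ (d + 5)) ^ (2 * α) :=
          Real.mul_rpow (by norm_num) (by positivity)
      _ ≤ 5 ^ (1 : ℝ) * √S := by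
          have : ((S : ℝ) ^ (d + 5)) ^ (2 * α) = √S := by
            rw [← Real.rpow_natCast, ← Real.rpow_mul hS0.le, Real.sqrt_eq_rpow, hα]
            congr 1
            push_cast
            field_simp
            norm_num
          rw [this]
          gcongr
          norm_num
      _ = 5 * √S := by rw [Real.rpow_one]
  have h2 : c * (5 * K ^ 2) < √S := Real.lt_sqrt_of_sq_lt hsq
  calc c * (K * l ^ α) ^ 2 = c * (K ^ 2 * (l ^ α) ^ 2) := by rw [mul_pow]
    _ ≤ c * (K ^ 2 * (5 * √S)) := by gcongr
    _ = c * (5 * K ^ 2) * √S := by ring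
    _ < √S * √S := mul_lt_mul_of_pos_right h2 (Real.sqrt_pos.2 hS0)
    _ = S := Real.mul_self_sqrt hS0.le

variable {d : ℕ}

/-- A function with values in `[-1, 1]` such that, for `φ` bounded by `B`, no density within
`ε / 4` of `φ + ε σ` is transported to Lebesgue measure by a map satisfying the
`t (log (1 / t)) ^ α`-bounds with constant `K`. -/
lemma exists_sign_forall_not_map_eq (hd : 2 ≤ d) {α : ℝ} (hα : α = 1 / (4 * (d + 5))) {K : ℝ}
    (hK : 1 ≤ K) {φ : Euc d → ℝ} (hφm : Measurable φ) (hφ : Integrable φ) {ε B : ℝ} (hε : 0 < ε)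
    (hB : 0 ≤ B) :
    ∃ σ : Euc d → ℝ, Measurable σ ∧ (∀ x, |σ x| = 1) ∧ ∀ (ρ : Euc d → ℝ) (f : Euc d → Euc d),
      IntegrableOn ρ (unitCube d) →
      (∀ᵐ x ∂volume.restrict (unitCube d), 0 ≤ ρ x ∧ ρ x ≤ B ∧ |ρ x - (φ x + ε * σ x)| ≤ ε / 4) →
      InjOn f (unitCube d) →
      (∀ x ∈ unitCube d, ∀ y ∈ unitCube d, 0 < dist x y → dist x y < Real.exp (-1) →
        dist (f x) (f y) ≤ K * (dist x y * Real.log (1 / dist x y) ^ α)) →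
      (∀ x ∈ unitCube d, ∀ y ∈ unitCube d, 0 < dist (f x) (f y) →
        dist (f x) (f y) < Real.exp (-1) →
        dist x y ≤ K * (dist (f x) (f y) * Real.log (1 / dist (f x) (f y)) ^ α)) →
      Measure.map f ((volume.restrict (unitCube d)).withDensity
        fun x => ENNReal.ofReal (ρ x)) ≠ volume.restrict (f '' unitCube d) := by
  have hα0 : 0 < α := by rw [hα]; positivity
  have hα1 : α ≤ 1 := by
    rw [hα, div_le_one (by positivity)]
    have : (0 : ℝ) ≤ d := by positivity
    linarith
  have hd0 : (0 : ℝ) < d := by exact_mod_cast (by omega : 0 < d)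
  have hexp : (1 : ℝ) / 8 < Real.exp (-1) := by
    rw [Real.exp_neg, ← one_div]
    exact one_div_lt_one_div_of_lt (Real.exp_pos _) (Real.exp_one_lt_three.trans (by norm_num))
  let i₀ : Fin d := ⟨0, by omega⟩
  let k₁ : Fin d := ⟨1, by omega⟩
  have hk₁ : k₁ ≠ i₀ := by simp [i₀, k₁]
  obtain ⟨δ, hδ, hφδ⟩ := exists_lintegral_translation_sub_le hφ
    (e := ENNReal.ofReal (ε / 4 / 4 ^ d)) (ENNReal.ofReal_pos.2 (by positivity))
  obtain ⟨r, hr, hrlt⟩ := exists_between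
    (lt_min hδ (lt_min (by norm_num : (0 : ℝ) < 1 / 16) (by positivity : 0 < 1 / 8 / (d : ℝ))))
  obtain ⟨hrδ, h'⟩ := lt_min_iff.1 hrlt
  obtain ⟨hr16, hrd⟩ := lt_min_iff.1 h'
  have hdr : d * r ≤ 1 / 8 := by
    rw [lt_div_iff₀ hd0] at hrd
    linarith
  obtain ⟨S, hS, hSL⟩ := exists_scale (K := K) d hr (10 * d + 20 * d * 2 ^ d * B / ε)
    (by positivity)
  have hS0 : 0 < S := by omega
  have hSR : (1 : ℝ) ≤ S := by exact_mod_cast hS0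
  have hstep := stepLen_pos hS0 hr
  have hstepr : ∀ j, stepLen S r j ≤ r := fun j => by
    have := stepLen_anti hS0 hr (Nat.zero_le j)
    rwa [stepLen_zero] at this
  set M := 2 * S ^ (d + 4) with hM
  have hlog : 1 ≤ Real.log (1 / stepLen S r M) :=
    one_le_log_one_div (hstep M) (by linarith [hstepr M])
  have hlt := hSL α hα hlog
  set L := K * Real.log (1 / stepLen S r M) ^ α with hL
  have hL1 : 1 ≤ L := one_le_mul_of_one_le_of_one_le hK (Real.one_le_rpow hlog hα0.le)
  rw [add_mul] at hlt
  have hLS : 10 * d * L ^ 2 ≤ S := by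
    have : 0 ≤ 20 * d * 2 ^ d * B / ε * L ^ 2 := by positivity
    linarith
  have hBS : 20 * d * 2 ^ d * B * L ^ 2 < ε * S := by
    have h1 : 0 ≤ 10 * d * L ^ 2 := by positivity
    have h2 : 20 * d * 2 ^ d * B / ε * L ^ 2 < S := by linarith
    rw [div_mul_eq_mul_div, div_lt_iff₀ hε] at h2
    linarith
  obtain ⟨p, hp, hosc⟩ := exists_sum_shiftMean_le hφm (e₁ := EuclideanSpace.single i₀ (1 : ℝ))
    (fun n : CellIndex M (S ^ 2) (Fin d → Fin S) => cellWeight n)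
    (fun n => stepLen S r n.1 / S) (cellOffset i₀ r)
    (fun n => by unfold cellWeight; positivity) (fun n => div_pos (hstep _) (by positivity))
    (e := ε / 4 / 4 ^ d) (by positivity) (fun n => hφδ _ (by
      rw [norm_smul, PiLp.norm_single, norm_one, mul_one, Real.norm_of_nonneg
        (div_nonneg (hstep _).le (by positivity))]
      exact ((div_le_self (hstep _).le hSR).trans (hstepr _)).trans_lt hrδ))
  rw [mul_div_cancel₀ _ (by positivity : (4 : ℝ) ^ d ≠ 0)] at hosc
  refine ⟨fun x => multiscaleSign i₀ S r M 0 (x - p),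
    (measurable_multiscaleSign M 0).comp (measurable_id.sub_const p),
    fun x => abs_multiscaleSign M 0 _, fun ρ f hρC hρ hinj hf hf' hmap => ?_⟩
  refine false_of_oscillation hk₁ hS hM hr hr16.le hdr hp hL1 hLS ?_ ?_
    (continuousOn_of_modulus hα1 (by linarith) (fun x y h => by simp [dist_eq_zero.1 h]) hf)
    hinj hε hB hBS hmap hρC (hρ.mono fun x h => h.1) (hρ.mono fun x h => h.2.1)
    (hρ.mono fun x h => ?_) (hρ.mono fun x h => ?_) hφ hosc
  · exact fun x hx y hy t ht ht8 hxy => le_mul_of_le_modulus hα0.le hα1 (by linarith)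
      (hf x hx y hy) dist_nonneg (fun h => by simp [dist_eq_zero.1 h]) hxy (hstep M) ht
      (ht8.trans_lt hexp)
  · exact fun x hx y hy t ht ht8 hxy => le_mul_of_le_modulus hα0.le hα1 (by linarith)
      (hf' x hx y hy) dist_nonneg (fun h => by simp [hinj hx hy (dist_eq_zero.1 h)]) hxy
      (hstep M) ht (ht8.trans_lt hexp)
  · linarith [(abs_le.1 h.2.2).1]
  · linarith [(abs_le.1 h.2.2).2]

end Parameters

section Porosity

variable {d : ℕ}

/-- The densities realised by injective maps whose bounds hold with the constant `K`. -/
def realizableDensities (d : ℕ) (α a K : ℝ) : Set (Lp ℝ ⊤ (volume.restrict (unitCube d))) :=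
  {ρ | (∀ᵐ x ∂(volume.restrict (unitCube d)), 0 < ρ x) ∧ ∃ f : Euc d → Euc d,
    InjOn f (unitCube d) ∧
    (∀ x ∈ unitCube d, ∀ y ∈ unitCube d, 0 < dist x y → dist x y < a →
      dist (f x) (f y) ≤ K * (dist x y * Real.log (1 / dist x y) ^ α)) ∧
    (∀ x ∈ unitCube d, ∀ y ∈ unitCube d, 0 < dist (f x) (f y) → dist (f x) (f y) < a →
      dist x y ≤ K * (dist (f x) (f y) * Real.log (1 / dist (f x) (f y)) ^ α)) ∧
    Measure.map f ((volume.restrict (unitCube d)).withDensity fun x => ENNReal.ofReal (ρ x)) =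
      volume.restrict (f '' unitCube d)}

lemma volume_unitCube_lt_top : volume (unitCube d) < ⊤ := by
  refine (Bornology.IsBounded.measure_lt_top ?_)
  have h : unitCube d = WithLp.ofLp ⁻¹' Set.pi univ fun _ : Fin d => Icc (0 : ℝ) 1 := by
    ext x; simp [unitCube, forall_and, Pi.le_def]
  rw [h]
  exact (PiLp.antilipschitzWith_ofLp 2 fun _ : Fin d => ℝ).isBounded_preimage
    (Bornology.IsBounded.pi fun _ => isBounded_Icc 0 1)

lemma ae_norm_le_norm {X : Type*} [MeasurableSpace X] {μ : Measure X} (u : Lp ℝ ⊤ μ) :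
    ∀ᵐ x ∂μ, |u x| ≤ ‖u‖ := by
  have h := ae_le_eLpNormEssSup (f := u) (μ := μ)
  rw [← eLpNorm_exponent_top] at h
  filter_upwards [h] with x hx
  rw [← Real.norm_eq_abs, ← toReal_enorm, Lp.norm_def]
  exact ENNReal.toReal_mono (Lp.eLpNorm_ne_top u) hx

lemma isPorous_realizableDensities (hd : 2 ≤ d) {α K : ℝ} (hα : α = 1 / (4 * (d + 5)))
    (hK : 1 ≤ K) : IsPorous (realizableDensities d α (Real.exp (-1)) K) := by
  intro φ
  have : IsFiniteMeasure (volume.restrict (unitCube d)) :=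
    ⟨by rw [Measure.restrict_apply_univ]; exact volume_unitCube_lt_top⟩
  refine ⟨1, one_pos, 1 / 4, by norm_num, fun ε hε => ?_⟩
  have hint : ∀ u : Lp ℝ ⊤ (volume.restrict (unitCube d)), IntegrableOn u (unitCube d) :=
    fun u => (Lp.memLp u).integrable le_top
  have hφm : Measurable φ := (Lp.stronglyMeasurable φ).measurable
  obtain ⟨σ, hσm, hσ, hbad⟩ := exists_sign_forall_not_map_eq hd hα hK
    (hφm.indicator measurableSet_unitCube)
    ((hint φ).integrable_indicator measurableSet_unitCube) hε.1
    (by positivity : 0 ≤ ‖φ‖ + 2)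
  have hσL : MemLp (fun x => ε * σ x) ⊤ (volume.restrict (unitCube d)) :=
    memLp_top_of_bound (hσm.const_mul ε).aestronglyMeasurable ε (.of_forall fun x => by
      rw [Real.norm_eq_abs, abs_mul, hσ, mul_one, abs_of_pos hε.1])
  have hnorm : ‖hσL.toLp‖ ≤ ε := (Lp.norm_le_of_ae_bound hε.1.le (by
    filter_upwards [hσL.coeFn_toLp] with x hx
    rw [hx, Real.norm_eq_abs, abs_mul, hσ, mul_one, abs_of_pos hε.1])).trans (by simp)
  refine ⟨φ + hσL.toLp, by simpa using hnorm, ?_⟩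
  refine eq_empty_of_forall_notMem fun ρ ⟨hρ, hpos, f, hinj, hf, hf', hmap⟩ => ?_
  rw [mem_ball, dist_eq_norm] at hρ
  have hρn : ‖ρ‖ ≤ ‖φ‖ + 2 := by
    have h1 := norm_add_le (ρ - (φ + hσL.toLp)) (φ + hσL.toLp)
    have h2 := norm_add_le φ hσL.toLp
    rw [sub_add_cancel] at h1
    linarith [hε.1, hε.2]
  refine hbad ρ f (hint ρ) ?_ hinj hf hf' hmap
  filter_upwards [hpos, ae_norm_le_norm ρ, ae_norm_le_norm (ρ - (φ + hσL.toLp)),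
    Lp.coeFn_sub ρ (φ + hσL.toLp), Lp.coeFn_add φ hσL.toLp, hσL.coeFn_toLp,
    ae_restrict_mem measurableSet_unitCube] with x h0 h1 h2 h3 h4 h5 hx
  refine ⟨h0.le, (le_abs_self _).trans (h1.trans hρn), ?_⟩
  rw [h3, Pi.sub_apply, h4, Pi.add_apply, h5] at h2
  rw [indicator_of_mem hx]
  linarith

lemma setOf_isBiOmegaMapOn_eq_iUnion (d : ℕ) (α : ℝ) :
    {ρ : Lp ℝ ⊤ (volume.restrict (unitCube d)) |
      (∀ᵐ x ∂(volume.restrict (unitCube d)), 0 < ρ x) ∧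
      ∃ f : Euc d → Euc d,
        IsBiOmegaMapOn (fun t : ℝ => t * (Real.log (1 / t)) ^ α) (Real.exp (-1)) f
          (unitCube d) ∧
        Measure.map f ((volume.restrict (unitCube d)).withDensity
          fun x => ENNReal.ofReal (ρ x)) = volume.restrict (f '' unitCube d)} =
      ⋃ n : ℕ, realizableDensities d α (Real.exp (-1)) (n + 1) := by
  ext ρ
  simp only [mem_iUnion, mem_ofPred_eq, realizableDensities]
  constructor
  · rintro ⟨hpos, f, ⟨hinj, K, hK, hf, hf'⟩, hmap⟩
    obtain ⟨n, hn⟩ := exists_nat_ge K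
    have hmono : ∀ A B : ℝ, 0 < A → A < Real.exp (-1) →
        B ≤ K * (A * Real.log (1 / A) ^ α) → B ≤ (n + 1) * (A * Real.log (1 / A) ^ α) :=
      fun A B hA hA' hB => by
        have := one_le_log_one_div hA hA'.le
        refine hB.trans (mul_le_mul_of_nonneg_right (by linarith) (by positivity))
    exact ⟨n, hpos, f, hinj, fun x hx y hy h h' => hmono _ _ h h' (hf x hx y hy h h'),
      fun x hx y hy h h' => hmono _ _ h h' (hf' x hx y hy h h'), hmap⟩
  · rintro ⟨n, hpos, f, hinj, hf, hf', hmap⟩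
    exact ⟨hpos, f, ⟨hinj, n + 1, by positivity, hf, hf'⟩, hmap⟩

end Porosity

/-- For `d ≥ 2` there are `α₀ > 0` and `a ∈ (0,1)` such that, with
`ω(t) = t (log(1/t))^{α₀}` on `(0,a)`, the set of `ρ ∈ L^∞(I^d)` which are positive almost
everywhere and for which the pushforward equation `f_♯(ρ·𝓛) = 𝓛|_{f(I^d)}` admits an injective
bi-`ω` solution `f : I^d → ℝ^d` is a σ-porous subset of `L^∞(I^d)` with the essential supremum
norm. -/
theorem statement_4 (d : ℕ) (hd : 2 ≤ d) :
    ∃ α₀ : ℝ, 0 < α₀ ∧ ∃ a : ℝ, 0 < a ∧ a < 1 ∧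
      IsSigmaPorous {ρ : MeasureTheory.Lp ℝ ⊤ (volume.restrict (unitCube d)) |
        (∀ᵐ x ∂(volume.restrict (unitCube d)), 0 < ρ x) ∧
        ∃ f : Euc d → Euc d,
          IsBiOmegaMapOn (fun t : ℝ => t * (Real.log (1/t)) ^ α₀) a f (unitCube d) ∧
          Measure.map f
              ((volume.restrict (unitCube d)).withDensity
                fun x => ENNReal.ofReal (ρ x))
            = volume.restrict (f '' unitCube d)} := by
  refine ⟨1 / (4 * (d + 5)), by positivity, Real.exp (-1), Real.exp_pos _,
    Real.exp_lt_one_iff.2 (by norm_num), fun n => realizableDensities d _ _ (n + 1),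
    fun n => isPorous_realizableDensities hd rfl ?_,
    setOf_isBiOmegaMapOn_eq_iUnion d (1 / (4 * (d + 5)))⟩
  have : (0 : ℝ) ≤ n := n.cast_nonneg
  linarith
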